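/- There exists d ≥ 40 for which the following holds. For every x ∈ (0, 2^{-d}) and every graph G with no copy of the complement of P5 and with |G| ≥ x^{-d}, there exist a real k with 2 ≤ k ≤ 1/x and a blockade in G that is pure or x-sparse and is a (k, |G|/k^d)-blockade. -/

import Mathlib

open Finset
open scoped Classical

/-- A copy of `H` in `G`: an injective map preserving adjacency and non-adjacency. -/
def IsCopy {W V : Type*} (H : SimpleGraph W) (G : SimpleGraph V) (f : W → V) : Prop :=
  Function.Injective f ∧ ∀ u v : W, H.Adj u v ↔ G.Adj (f u) (f v)

/-- `G` is `H`-free: there is no copy of `H` in `G`. -/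
def Free {W V : Type*} (H : SimpleGraph W) (G : SimpleGraph V) : Prop :=
  ¬ ∃ f : W → V, IsCopy H G f

/-- The path on five vertices. -/
def P5 : SimpleGraph (Fin 5) := SimpleGraph.pathGraph 5

/-- The neighbours of `v` inside the finite set `A`. -/
noncomputable def nbrsIn {V : Type*} (G : SimpleGraph V) (v : V) (A : Finset V) : Finset V :=
  A.filter (fun u => G.Adj v u)

/-- `G` is `x`-sparse: every vertex has degree at most `x * |G|`. -/
def Sparse {V : Type*} [Fintype V] (G : SimpleGraph V) (x : ℝ) : Prop :=
  ∀ v : V, ((nbrsIn G v Finset.univ).card : ℝ) ≤ x * (Fintype.card V : ℝ)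

/-- `G` is `x`-restricted: `G` or its complement is `x`-sparse. -/
def Restricted {V : Type*} [Fintype V] (G : SimpleGraph V) (x : ℝ) : Prop :=
  Sparse G x ∨ Sparse Gᶜ x

/-- The induced subgraph `G[S]` is `x`-sparse. -/
def SparseOn {V : Type*} (G : SimpleGraph V) (S : Finset V) (x : ℝ) : Prop :=
  ∀ v ∈ S, ((nbrsIn G v S).card : ℝ) ≤ x * (S.card : ℝ)

/-- The induced subgraph `G[S]` is `x`-restricted: it or its complement is `x`-sparse. -/
def RestrictedOn {V : Type*} (G : SimpleGraph V) (S : Finset V) (x : ℝ) : Prop :=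
  SparseOn G S x ∨ SparseOn Gᶜ S x

/-- `(A, B)` is complete in `G`. -/
def CompletePair {V : Type*} (G : SimpleGraph V) (A B : Finset V) : Prop :=
  ∀ a ∈ A, ∀ b ∈ B, G.Adj a b

/-- `(A, B)` is anticomplete in `G`. -/
def AnticompletePair {V : Type*} (G : SimpleGraph V) (A B : Finset V) : Prop :=
  ∀ a ∈ A, ∀ b ∈ B, ¬ G.Adj a b

/-- `B` is `x`-sparse to `A` in `G`: every vertex of `B` has at most `x * |A|` neighbours in `A`. -/
def SparseTo {V : Type*} (G : SimpleGraph V) (x : ℝ) (A B : Finset V) : Prop :=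
  ∀ v ∈ B, ((nbrsIn G v A).card : ℝ) ≤ x * (A.card : ℝ)

/-- The number of edges of `G` between `A` and `B`. -/
noncomputable def edgesBetween {V : Type*} (G : SimpleGraph V) (A B : Finset V) : ℕ :=
  ((A ×ˢ B).filter (fun p => G.Adj p.1 p.2)).card

/-- `(A, B)` is weakly `x`-sparse in `G`. -/
def WeaklySparse {V : Type*} (G : SimpleGraph V) (x : ℝ) (A B : Finset V) : Prop :=
  (edgesBetween G A B : ℝ) ≤ x * (A.card : ℝ) * (B.card : ℝ)

/-- A blockade: a sequence of pairwise disjoint vertex subsets. -/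
def IsBlockade {V : Type*} {n : ℕ} (B : Fin n → Finset V) : Prop :=
  ∀ i j : Fin n, i ≠ j → Disjoint (B i) (B j)

/-- A pure blockade: every pair of distinct blocks is complete or anticomplete. -/
def PureBlockade {V : Type*} (G : SimpleGraph V) {n : ℕ} (B : Fin n → Finset V) : Prop :=
  ∀ i j : Fin n, i ≠ j → CompletePair G (B i) (B j) ∨ AnticompletePair G (B i) (B j)

/-- A complete blockade. -/
def CompleteBlockade {V : Type*} (G : SimpleGraph V) {n : ℕ} (B : Fin n → Finset V) : Prop :=
  ∀ i j : Fin n, i ≠ j → CompletePair G (B i) (B j)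

/-- An anticomplete blockade. -/
def AnticompleteBlockade {V : Type*} (G : SimpleGraph V) {n : ℕ} (B : Fin n → Finset V) : Prop :=
  ∀ i j : Fin n, i ≠ j → AnticompletePair G (B i) (B j)

/-- An `x`-sparse blockade: `B j` is `x`-sparse to `B i` whenever `i < j`. -/
def SparseBlockade {V : Type*} (G : SimpleGraph V) (x : ℝ) {n : ℕ} (B : Fin n → Finset V) : Prop :=
  ∀ i j : Fin n, i < j → SparseTo G x (B i) (B j)

/-- A comb: a blockade `Bl` together with distinct apexes `a i`, outside all blocks, such that
`a i` is adjacent to all of `Bl i` and nonadjacent to all of `Bl j` for `j ≠ i`. -/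
def IsComb {V : Type*} (G : SimpleGraph V) {k : ℕ} (a : Fin k → V) (Bl : Fin k → Finset V) :
    Prop :=
  IsBlockade Bl ∧ Function.Injective a ∧ (∀ i j : Fin k, a i ∉ Bl j) ∧
  (∀ i : Fin k, ∀ v ∈ Bl i, G.Adj (a i) v) ∧
  (∀ i j : Fin k, i ≠ j → ∀ v ∈ Bl j, ¬ G.Adj (a i) v)


section HouseFree

variable {V : Type*}

/-- `D` cannot be split into two nonempty parts with no edges of `H` between them. -/
def CutConnected (H : SimpleGraph V) (D : Finset V) : Prop :=
  ∀ Y ⊆ D, Y.Nonempty → (D \ Y).Nonempty → ∃ y ∈ Y, ∃ z ∈ D \ Y, H.Adj y z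

theorem mem_nbrsIn {G : SimpleGraph V} {v u : V} {A : Finset V} :
    u ∈ nbrsIn G v A ↔ u ∈ A ∧ G.Adj v u := by
  simp [nbrsIn]

theorem nbrsIn_subset (G : SimpleGraph V) (v : V) (A : Finset V) : nbrsIn G v A ⊆ A :=
  Finset.filter_subset _ _

theorem nbrsIn_mono (G : SimpleGraph V) (v : V) {A B : Finset V} (h : A ⊆ B) :
    nbrsIn G v A ⊆ nbrsIn G v B :=
  Finset.filter_subset_filter _ h

theorem sum_card_nbrsIn_comm (G : SimpleGraph V) (A B : Finset V) :
    ∑ a ∈ A, (nbrsIn G a B).card = ∑ b ∈ B, (nbrsIn G b A).card := by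
  have h := Finset.sum_card_bipartiteAbove_eq_sum_card_bipartiteBelow (s := A) (t := B) G.Adj
  simp only [Finset.bipartiteAbove, Finset.bipartiteBelow] at h
  simpa only [nbrsIn, G.adj_comm] using h

/-- A house-free graph has no induced five-vertex path in its complement. -/
theorem no_path_compl {G : SimpleGraph V} (hG : Free P5ᶜ G) {a b c d e : V}
    (hab : Gᶜ.Adj a b) (hbc : Gᶜ.Adj b c) (hcd : Gᶜ.Adj c d) (hde : Gᶜ.Adj d e)
    (hac : ¬ Gᶜ.Adj a c) (had : ¬ Gᶜ.Adj a d) (hae : ¬ Gᶜ.Adj a e)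
    (hbd : ¬ Gᶜ.Adj b d) (hbe : ¬ Gᶜ.Adj b e) (hce : ¬ Gᶜ.Adj c e) : False := by
  have nac : a ≠ c := by rintro rfl; exact had hcd
  have nad : a ≠ d := by rintro rfl; exact hac hcd.symm
  have nae : a ≠ e := by rintro rfl; exact had hde.symm
  have nbd : b ≠ d := by rintro rfl; exact hbe hde
  have nbe : b ≠ e := by rintro rfl; exact hae hab
  have nce : c ≠ e := by rintro rfl; exact hbe hbc
  have nab := hab.ne
  have nbc := hbc.ne
  have ncd := hcd.ne
  have nde := hde.ne
  simp only [SimpleGraph.compl_adj, not_and, not_not] at hab hbc hcd hde hac had hae hbd hbe hce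
  apply hG
  refine ⟨![a, b, c, d, e], ?_, ?_⟩
  · intro i j hij
    fin_cases i <;> fin_cases j <;> simp_all [eq_comm]
  · intro i j
    fin_cases i <;> fin_cases j <;>
      simp_all [P5, SimpleGraph.pathGraph_adj, SimpleGraph.adj_comm, eq_comm]

theorem exists_disjoint_subsets_card_eq (q : ℕ) :
    ∀ (N : ℕ) (W : Finset V), N * q ≤ W.card →
      ∃ B : Fin N → Finset V, IsBlockade B ∧ ∀ i, B i ⊆ W ∧ (B i).card = q := by
  intro N
  induction N with
  | zero => intro W _; exact ⟨fun i => i.elim0, fun i => i.elim0, fun i => i.elim0⟩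
  | succ N ih =>
    intro W hW
    have hq : q ≤ W.card := le_trans (by nlinarith) hW
    obtain ⟨X, hXW, hX⟩ := Finset.exists_subset_card_eq hq
    have hcard : (W \ X).card = W.card - q := by rw [Finset.card_sdiff_of_subset hXW, hX]
    obtain ⟨B, hB, hBW⟩ := ih (W \ X) (by rw [hcard]; apply Nat.le_sub_of_add_le; linarith)
    have hd : ∀ i, Disjoint X (B i) := fun i =>
      Finset.disjoint_of_subset_right (hBW i).1 Finset.disjoint_sdiff
    refine ⟨Fin.cons X B, ?_, ?_⟩
    · intro i j hij
      cases i using Fin.cases with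
      | zero =>
        cases j using Fin.cases with
        | zero => exact absurd rfl hij
        | succ j => simpa using hd j
      | succ i =>
        cases j using Fin.cases with
        | zero => simpa using (hd i).symm
        | succ j => simpa using hB i j (fun h => hij (by rw [h]))
    · intro i
      cases i using Fin.cases with
      | zero => exact ⟨by simpa using hXW, by simpa using hX⟩
      | succ i =>
        exact ⟨by simpa using (hBW i).1.trans Finset.sdiff_subset, by simpa using (hBW i).2⟩

/-- Either some component of `H[W]` is large, or components can be grouped into `N` large
pairwise anticomplete sets. -/
theorem exists_component_or_anticomplete (H : SimpleGraph V) {s : ℝ} (hs : 0 < s) :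
    ∀ (N : ℕ) (W : Finset V), 2 * s * N ≤ (W.card : ℝ) →
      (∃ D ⊆ W, CutConnected H D ∧ s ≤ (D.card : ℝ) ∧ AnticompletePair H D (W \ D)) ∨
      ∃ B : Fin N → Finset V, IsBlockade B ∧ AnticompleteBlockade H B ∧
        ∀ i, B i ⊆ W ∧ s ≤ ((B i).card : ℝ) := by
  intro N
  induction N with
  | zero =>
    intro W _
    exact Or.inr ⟨fun i => i.elim0, fun i => i.elim0, fun i => i.elim0, fun i => i.elim0⟩
  | succ N ih =>
    intro W hW
    push_cast at hW
    by_cases hD : ∃ D ⊆ W, CutConnected H D ∧ s ≤ (D.card : ℝ) ∧ AnticompletePair H D (W \ D)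
    · exact Or.inl hD
    right
    have hN : (0 : ℝ) ≤ N := Nat.cast_nonneg N
    obtain ⟨X, hXmem, hXmin⟩ := Finset.exists_min_image
      (W.powerset.filter fun X => s ≤ (X.card : ℝ) ∧ AnticompletePair H X (W \ X))
      Finset.card ⟨W, by
        simp only [Finset.mem_filter, Finset.mem_powerset, subset_refl, true_and]
        refine ⟨by nlinarith, ?_⟩
        intro a _ b hb
        simp at hb⟩
    simp only [Finset.mem_filter, Finset.mem_powerset] at hXmem hXmin
    obtain ⟨hXW, hXs, hXc⟩ := hXmem
    have hX2 : (X.card : ℝ) < 2 * s := by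
      have hnc : ¬ CutConnected H X := fun h => hD ⟨X, hXW, h, hXs, hXc⟩
      unfold CutConnected at hnc
      push Not at hnc
      obtain ⟨Y, hYX, hYn, hZn, hYZ⟩ := hnc
      have hcard : (X \ Y).card + Y.card = X.card := Finset.card_sdiff_add_card_eq_card hYX
      have hYpos := hYn.card_pos
      have hZpos := hZn.card_pos
      have h1 : (Y.card : ℝ) < s := by
        by_contra hcon
        have := hXmin Y ⟨hYX.trans hXW, not_lt.mp hcon, by
          intro a ha b hb
          rw [Finset.mem_sdiff] at hb
          by_cases hbX : b ∈ X
          · exact hYZ a ha b (Finset.mem_sdiff.2 ⟨hbX, hb.2⟩)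
          · exact hXc a (hYX ha) b (Finset.mem_sdiff.2 ⟨hb.1, hbX⟩)⟩
        omega
      have h2 : ((X \ Y).card : ℝ) < s := by
        by_contra hcon
        have := hXmin (X \ Y) ⟨Finset.sdiff_subset.trans hXW, not_lt.mp hcon, by
          intro a ha b hb hadj
          rw [Finset.mem_sdiff] at hb
          by_cases hbX : b ∈ X
          · have hbY : b ∈ Y := by
              by_contra hbY
              exact hb.2 (Finset.mem_sdiff.2 ⟨hbX, hbY⟩)
            exact hYZ b hbY a ha hadj.symm
          · exact hXc a (Finset.sdiff_subset ha) b (Finset.mem_sdiff.2 ⟨hb.1, hbX⟩) hadj⟩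
        omega
      have : (X.card : ℝ) = (X \ Y).card + Y.card := by exact_mod_cast hcard.symm
      linarith
    have hcW : ((W \ X).card : ℝ) = W.card - X.card := by
      rw [← Finset.card_sdiff_add_card_eq_card hXW]
      push_cast
      ring
    rcases ih (W \ X) (by rw [hcW]; linarith) with ⟨D, hDW, hDc, hDs, hDa⟩ | ⟨B, hB, hBa, hBW⟩
    · exfalso
      refine hD ⟨D, hDW.trans Finset.sdiff_subset, hDc, hDs, ?_⟩
      intro a ha b hb hadj
      rw [Finset.mem_sdiff] at hb
      by_cases hbX : b ∈ X
      · exact hXc b hbX a (hDW ha) hadj.symm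
      · exact hDa a ha b (by simp [hb.1, hb.2, hbX]) hadj
    · have hd : ∀ i, Disjoint X (B i) := fun i =>
        Finset.disjoint_of_subset_right (hBW i).1 Finset.disjoint_sdiff
      have ha : ∀ i, AnticompletePair H X (B i) := fun i a haX b hb =>
        hXc a haX b ((hBW i).1 hb)
      refine ⟨Fin.cons X B, ?_, ?_, ?_⟩
      · intro i j hij
        cases i using Fin.cases with
        | zero =>
          cases j using Fin.cases with
          | zero => exact absurd rfl hij
          | succ j => simpa using hd j
        | succ i =>
          cases j using Fin.cases with
          | zero => simpa using (hd i).symm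
          | succ j => simpa using hB i j (fun h => hij (by rw [h]))
      · intro i j hij
        cases i using Fin.cases with
        | zero =>
          cases j using Fin.cases with
          | zero => exact absurd rfl hij
          | succ j => simpa using ha j
        | succ i =>
          cases j using Fin.cases with
          | zero =>
            intro a haB b hb hadj
            exact ha i b (by simpa using hb) a (by simpa using haB) hadj.symm
          | succ j => simpa using hBa i j (fun h => hij (by rw [h]))
      · intro i
        cases i using Fin.cases with
        | zero => exact ⟨by simpa using hXW, by simpa using hXs⟩
        | succ i =>
          exact ⟨by simpa using (hBW i).1.trans Finset.sdiff_subset, by simpa using (hBW i).2⟩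

theorem card_nbrsIn_eq_add (G : SimpleGraph V) (v : V) {A B : Finset V} (h : A ⊆ B) :
    (nbrsIn G v B).card = (nbrsIn G v (B \ A)).card + (nbrsIn G v A).card := by
  rw [← Finset.card_union_of_disjoint]
  · congr 1
    ext u
    simp only [mem_nbrsIn, Finset.mem_union, Finset.mem_sdiff]
    constructor
    · rintro ⟨h1, h2⟩
      by_cases hA : u ∈ A
      · exact Or.inr ⟨hA, h2⟩
      · exact Or.inl ⟨⟨h1, hA⟩, h2⟩
    · rintro (⟨⟨h1, -⟩, h2⟩ | ⟨h1, h2⟩)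
      · exact ⟨h1, h2⟩
      · exact ⟨h h1, h2⟩
  · exact Finset.disjoint_of_subset_left (nbrsIn_subset _ _ _)
      (Finset.disjoint_of_subset_right (nbrsIn_subset _ _ _) Finset.sdiff_disjoint)

theorem exists_comb_of_card_nbrsIn_le_aux (G : SimpleGraph V) (A : Finset V) {θ : ℝ} (hθ : 0 < θ) :
    ∀ (n : ℕ) (B : Finset V), B.card = n → (∀ a ∈ A, ((nbrsIn G a B).card : ℝ) ≤ θ) →
      ∃ (I : Finset V) (C : V → Finset V) (B' : Finset V) (p : ℝ), I ⊆ A ∧ B' ⊆ B ∧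
        (∀ a ∈ I, C a ⊆ nbrsIn G a B ∧ θ / 8 ≤ ((C a).card : ℝ) ∧
          ∀ a' ∈ I, a' ≠ a → ∀ v ∈ C a, ¬ G.Adj a' v) ∧
        (∀ a ∈ A, ((nbrsIn G a B').card : ℝ) ≤ θ / 4) ∧
        (B.card : ℝ) ≤ B'.card + θ * p ∧
        (p - I.card) * (θ / 8) ≤ ∑ j ∈ I, ((nbrsIn G j B).card : ℝ) := by
  intro n
  induction n using Nat.strong_induction_on with
  | _ n ih =>
  intro B hBn hB
  by_cases hsmall : ∀ a ∈ A, ((nbrsIn G a B).card : ℝ) ≤ θ / 4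
  · exact ⟨∅, fun _ => ∅, B, 0, by simp, subset_rfl, by simp, hsmall, by simp, by simp⟩
  push Not at hsmall
  obtain ⟨a, haA, ha⟩ := hsmall
  set K := nbrsIn G a B with hK
  have hKB : K ⊆ B := nbrsIn_subset _ _ _
  have hcard : (B \ K).card + K.card = B.card := Finset.card_sdiff_add_card_eq_card hKB
  have hKpos : 0 < K.card := by
    have : (0 : ℝ) < K.card := by linarith
    exact_mod_cast this
  have hcardR : ((B \ K).card : ℝ) + K.card = B.card := by exact_mod_cast hcard
  have hKθ : (K.card : ℝ) ≤ θ := hB a haA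
  obtain ⟨I, C, B', p, hIA, hB'B, hC, hB', hcardB, hpot⟩ := ih (B \ K).card (by omega) (B \ K) rfl
    (fun b hb => le_trans (by exact_mod_cast Finset.card_le_card (nbrsIn_mono G b sdiff_subset))
      (hB b hb))
  have hnot : ∀ v ∈ B \ K, ¬ G.Adj a v := by
    intro v hv hadj
    rw [Finset.mem_sdiff] at hv
    exact hv.2 (mem_nbrsIn.2 ⟨hv.1, hadj⟩)
  have haI : a ∉ I := by
    intro haI
    have h1 := (hC a haI).2.1
    have : (C a).Nonempty := by
      rw [← Finset.card_pos]
      have : (0 : ℝ) < (C a).card := by linarith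
      exact_mod_cast this
    obtain ⟨v, hv⟩ := this
    have := mem_nbrsIn.1 ((hC a haI).1 hv)
    exact hnot v this.1 this.2
  have hsplit : ∑ j ∈ I, ((nbrsIn G j B).card : ℝ) =
      ∑ j ∈ I, ((nbrsIn G j (B \ K)).card : ℝ) + ∑ j ∈ I, ((nbrsIn G j K).card : ℝ) := by
    rw [← Finset.sum_add_distrib]
    refine Finset.sum_congr rfl fun j _ => ?_
    exact_mod_cast card_nbrsIn_eq_add G j hKB
  have hCB : ∀ j ∈ I, C j ⊆ nbrsIn G j B := fun j hj =>
    (hC j hj).1.trans (nbrsIn_mono G j sdiff_subset)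
  by_cases hover : ∑ j ∈ I, ((nbrsIn G j K).card : ℝ) ≤ K.card / 2
  · refine ⟨insert a I, fun b => if b = a then K \ I.biUnion (fun j => nbrsIn G j K) else C b, B',
      p + 1, Finset.insert_subset haA hIA, hB'B.trans sdiff_subset, ?_, hB', by linarith, ?_⟩
    · have hne : ∀ j ∈ I, j ≠ a := fun j hj h => haI (h ▸ hj)
      intro b hb
      rcases Finset.mem_insert.1 hb with rfl | hbI
      · simp only [if_true]
        refine ⟨Finset.sdiff_subset, ?_, ?_⟩
        · have h1 : ((I.biUnion fun j => nbrsIn G j K).card : ℝ) ≤ K.card / 2 := by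
            refine le_trans ?_ hover
            exact_mod_cast Finset.card_biUnion_le
          have h2 : (K.card : ℝ) ≤ (K \ I.biUnion fun j => nbrsIn G j K).card +
              (I.biUnion fun j => nbrsIn G j K).card := by
            exact_mod_cast Finset.card_le_card_sdiff_add_card
          linarith
        · intro a' ha' hne' v hv hadj
          rcases Finset.mem_insert.1 ha' with rfl | ha'I
          · exact hne' rfl
          · rw [Finset.mem_sdiff, Finset.mem_biUnion] at hv
            exact hv.2 ⟨a', ha'I, mem_nbrsIn.2 ⟨hv.1, hadj⟩⟩
      · simp only [if_neg (hne b hbI)]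
        refine ⟨hCB b hbI, (hC b hbI).2.1, ?_⟩
        intro a' ha' hne' v hv hadj
        rcases Finset.mem_insert.1 ha' with rfl | ha'I
        · exact hnot v (mem_nbrsIn.1 ((hC b hbI).1 hv)).1 hadj
        · exact (hC b hbI).2.2 a' ha'I hne' v hv hadj
    · rw [Finset.card_insert_of_notMem haI, Finset.sum_insert haI, hsplit]
      have h1 : (0 : ℝ) ≤ ∑ j ∈ I, ((nbrsIn G j K).card : ℝ) :=
        Finset.sum_nonneg fun j _ => Nat.cast_nonneg _
      have h2 : (0 : ℝ) ≤ ((nbrsIn G a B).card : ℝ) := Nat.cast_nonneg _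
      push_cast
      linarith
  · push Not at hover
    refine ⟨I, C, B', p + 1, hIA, hB'B.trans sdiff_subset, ?_, hB', by linarith, ?_⟩
    · exact fun b hb => ⟨hCB b hb, (hC b hb).2⟩
    · rw [hsplit]
      linarith

theorem exists_comb_of_card_nbrsIn_le (G : SimpleGraph V) (A B : Finset V) {θ : ℝ} (hθ : 0 < θ)
    (hB : ∀ a ∈ A, ((nbrsIn G a B).card : ℝ) ≤ θ) :
    ∃ (I : Finset V) (C : V → Finset V) (B' : Finset V), I ⊆ A ∧ B' ⊆ B ∧
      (∀ a ∈ I, C a ⊆ nbrsIn G a B ∧ θ / 8 ≤ ((C a).card : ℝ) ∧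
        ∀ a' ∈ I, a' ≠ a → ∀ v ∈ C a, ¬ G.Adj a' v) ∧
      (∀ a ∈ A, ((nbrsIn G a B').card : ℝ) ≤ θ / 4) ∧
      (B.card : ℝ) ≤ B'.card + 9 * θ * I.card := by
  obtain ⟨I, C, B', p, hIA, hB'B, hC, hB', hcard, hpot⟩ :=
    exists_comb_of_card_nbrsIn_le_aux G A hθ _ B rfl hB
  refine ⟨I, C, B', hIA, hB'B, hC, hB', ?_⟩
  have h1 : ∑ j ∈ I, ((nbrsIn G j B).card : ℝ) ≤ I.card * θ := by
    rw [← nsmul_eq_mul]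
    exact Finset.sum_le_card_nsmul _ _ _ fun j hj => hB j (hIA hj)
  have h2 : p ≤ 9 * I.card := by
    by_contra hcon
    push Not at hcon
    nlinarith
  nlinarith

/-- Either there is a comb with many large blocks (with a trade-off between the number of blocks
and their size), or half of `B` is sparse to `A`. -/
theorem exists_comb_or_sparse (G : SimpleGraph V) (A B : Finset V) {Δ τ : ℝ} (hτ : 0 < τ)
    (hB : ∀ a ∈ A, ((nbrsIn G a B).card : ℝ) ≤ Δ) :
    (∃ (s : ℕ) (I : Finset V) (C : V → Finset V), τ ≤ Δ / 4 ^ s ∧ I ⊆ A ∧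
      (∀ a ∈ I, C a ⊆ nbrsIn G a B ∧ Δ / 4 ^ s / 8 ≤ ((C a).card : ℝ) ∧
        ∀ a' ∈ I, a' ≠ a → ∀ v ∈ C a, ¬ G.Adj a' v) ∧
      2 ^ s * (B.card : ℝ) ≤ 36 * I.card * Δ) ∨
    ∃ B' ⊆ B, (B.card : ℝ) / 2 ≤ B'.card ∧ ∀ a ∈ A, ((nbrsIn G a B').card : ℝ) ≤ τ := by
  by_contra hcon
  rw [not_or] at hcon
  obtain ⟨hno, hno'⟩ := hcon
  have key : ∀ s : ℕ, τ ≤ Δ / 4 ^ s ∧ ∃ B' ⊆ B, (B.card : ℝ) * (1 / 2 + 1 / 2 ^ s / 2) ≤ B'.card ∧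
      ∀ a ∈ A, ((nbrsIn G a B').card : ℝ) ≤ Δ / 4 ^ s := by
    intro s
    induction s with
    | zero =>
      have h : ∃ B' ⊆ B, (B.card : ℝ) * (1 / 2 + 1 / 2 ^ 0 / 2) ≤ B'.card ∧
          ∀ a ∈ A, ((nbrsIn G a B').card : ℝ) ≤ Δ / 4 ^ 0 :=
        ⟨B, subset_rfl, by norm_num, by simpa using hB⟩
      refine ⟨?_, h⟩
      by_contra hlt
      push Not at hlt
      exact hno' ⟨B, subset_rfl, by linarith [(Nat.cast_nonneg B.card : (0 : ℝ) ≤ _)],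
        fun a ha => (hB a ha).trans (by simpa using hlt.le)⟩
    | succ s ih =>
      obtain ⟨hτs, B1, hB1, hB1c, hB1s⟩ := ih
      have hθ : 0 < Δ / 4 ^ s := lt_of_lt_of_le hτ hτs
      obtain ⟨I, C, B', hIA, hB'B, hC, hB', hcard⟩ := exists_comb_of_card_nbrsIn_le G A B1 hθ hB1s
      have hI : 36 * I.card * Δ < 2 ^ s * (B.card : ℝ) := by
        by_contra hge
        push Not at hge
        exact hno ⟨s, I, C, hτs, hIA, fun a ha =>
          ⟨(hC a ha).1.trans (nbrsIn_mono G a hB1), (hC a ha).2⟩, hge⟩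
      have h4 : Δ / 4 ^ (s + 1) = Δ / 4 ^ s / 4 := by rw [pow_succ]; field_simp
      have hrem : 9 * (Δ / 4 ^ s) * I.card ≤ (B.card : ℝ) * (1 / 2 ^ s / 4) := by
        have h5 : (4 : ℝ) ^ s = 2 ^ s * 2 ^ s := by rw [← mul_pow]; norm_num
        rw [h5]
        have h6 : (0 : ℝ) < 2 ^ s := by positivity
        have h7 : 9 * (Δ / (2 ^ s * 2 ^ s)) * (I.card : ℝ) =
            36 * I.card * Δ / (2 ^ s * 2 ^ s * 4) := by field_simp; ring
        have h8 : (B.card : ℝ) * (1 / 2 ^ s / 4) = 2 ^ s * B.card / (2 ^ s * 2 ^ s * 4) := by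
          field_simp
        rw [h7, h8]
        gcongr
      have hcard' : (B.card : ℝ) * (1 / 2 + 1 / 2 ^ (s + 1) / 2) ≤ B'.card := by
        have : (1 : ℝ) / 2 ^ (s + 1) / 2 = 1 / 2 ^ s / 2 - 1 / 2 ^ s / 4 := by
          rw [pow_succ]; field_simp; norm_num
        rw [this]
        linarith
      refine ⟨?_, B', hB'B.trans hB1, hcard', by rw [h4]; exact hB'⟩
      by_contra hlt
      push Not at hlt
      rw [h4] at hlt
      have h9 : (0 : ℝ) ≤ B.card * (1 / 2 ^ (s + 1) / 2) := by positivity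
      exact hno' ⟨B', hB'B.trans hB1, by linarith, fun a ha => (hB' a ha).trans hlt.le⟩
  obtain ⟨s, hs⟩ := pow_unbounded_of_one_lt (Δ / τ) (by norm_num : (1 : ℝ) < 4)
  have h := (key s).1
  rw [le_div_iff₀ (by positivity)] at h
  rw [div_lt_iff₀ hτ] at hs
  linarith

theorem complete_or_anticomplete_to_vertex {G : SimpleGraph V} (hG : Free P5ᶜ G) {v b u : V}
    {D : Finset V} (hD : CutConnected Gᶜ D) (hDb : ∀ p ∈ D, G.Adj b p) (hDv : ∀ p ∈ D, G.Adj v p)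
    (hbv : Gᶜ.Adj b v) (hub : Gᶜ.Adj u b) (huv : G.Adj v u) :
    (∀ p ∈ D, G.Adj p u) ∨ ∀ p ∈ D, ¬ G.Adj p u := by
  by_contra hcon
  rw [not_or] at hcon
  obtain ⟨h1, h2⟩ := hcon
  push Not at h1 h2
  obtain ⟨q0, hq0, hq0u⟩ := h1
  obtain ⟨p0, hp0, hp0u⟩ := h2
  have huD : u ∉ D := fun hu => by
    have := hDb u hu
    simp only [SimpleGraph.compl_adj] at hub
    exact hub.2 this.symm
  obtain ⟨p, hp, q, hq, hpq⟩ := hD (D.filter fun p => G.Adj p u) (Finset.filter_subset _ _)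
    ⟨p0, by simp [hp0, hp0u]⟩ ⟨q0, by simp [hq0, hq0u]⟩
  simp only [Finset.mem_filter, Finset.mem_sdiff, not_and] at hp hq
  have hqu : ¬ G.Adj q u := hq.2 hq.1
  have hne : q ≠ u := by rintro rfl; exact huD hq.1
  refine no_path_compl hG hpq (c := u) ?_ hub hbv ?_ ?_ ?_ ?_ ?_ ?_
  · simp [hqu, hne]
  · simp [hp.2]
  · simp [(hDb p hp.1).symm]
  · simp [(hDv p hp.1).symm]
  · simp [(hDb q hq.1).symm]
  · simp [(hDv q hq.1).symm]
  · simp [huv.symm]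

theorem completePair_or_anticompletePair {G : SimpleGraph V} {D D' : Finset V}
    (h : ∀ u ∈ D', (∀ p ∈ D, G.Adj p u) ∨ ∀ p ∈ D, ¬ G.Adj p u)
    (h' : ∀ u ∈ D, (∀ p ∈ D', G.Adj p u) ∨ ∀ p ∈ D', ¬ G.Adj p u) :
    CompletePair G D D' ∨ AnticompletePair G D D' := by
  by_contra hcon
  rw [not_or] at hcon
  obtain ⟨h1, h2⟩ := hcon
  unfold CompletePair at h1
  unfold AnticompletePair at h2
  push Not at h1 h2
  obtain ⟨a, ha, b, hb, hab⟩ := h1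
  obtain ⟨a', ha', b', hb', hab'⟩ := h2
  rcases h b' hb' with h3 | h3
  · rcases h' a ha with h4 | h4
    · exact hab (h4 b hb).symm
    · exact h4 b' hb' (h3 a ha).symm
  · exact h3 a' ha' hab'

theorem AnticompleteBlockade.complete_of_compl {G : SimpleGraph V} {n : ℕ} {B : Fin n → Finset V}
    (hB : IsBlockade B) (h : AnticompleteBlockade Gᶜ B) : CompleteBlockade G B := by
  intro i j hij a ha b hb
  have hne : a ≠ b := by
    rintro rfl
    exact Finset.disjoint_left.1 (hB i j hij) ha hb
  have := h i j hij a ha b hb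
  simpa [hne] using this

/-- If the neighbourhoods of the vertices of `A` are sparse on a set `T` of neighbours of `v`, then
there is a large pure blockade, or half of `T` can be chosen so that `A` is very sparse to it. -/
theorem exists_pure_or_sparseTo {G : SimpleGraph V} (hG : Free P5ᶜ G) {x r : ℝ} (hx : 0 < x)
    (hr : 0 < r) (hr1 : r ≤ 1 / 1296) (hxr : x < 2 * r) (v : V) (T A : Finset V)
    (hTn : T.Nonempty) (hT : ∀ t ∈ T, G.Adj v t)
    (hA : ∀ b ∈ A, Gᶜ.Adj b v ∧ ((nbrsIn G b T).card : ℝ) ≤ r * T.card) :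
    (∃ k : ℝ, 1 / (36 * r) ≤ k ∧ k ≤ 1 / x ∧ ∃ (n : ℕ) (B : Fin n → Finset V), IsBlockade B ∧
      k ≤ n ∧ (∀ i, (T.card : ℝ) / (41472 * k ^ 3) ≤ ((B i).card : ℝ)) ∧ PureBlockade G B) ∨
    ∃ T' ⊆ T, (T.card : ℝ) / 2 ≤ T'.card ∧ SparseTo G x T' A := by
  have hTpos : (0 : ℝ) < T.card := by exact_mod_cast hTn.card_pos
  rcases exists_comb_or_sparse G A T (Δ := r * T.card) (τ := x * T.card / 2) (by positivity)
    (fun a ha => (hA a ha).2) with ⟨s, I, C, hs, hIA, hC, hI⟩ | ⟨T', hT'T, hT'c, hT's⟩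
  · left
    have h4s : (4 : ℝ) ^ s = 2 ^ s * 2 ^ s := by rw [← mul_pow]; norm_num
    have h2pos : (0 : ℝ) < 2 ^ s := by positivity
    have h2one : (1 : ℝ) ≤ 2 ^ s := one_le_pow₀ (by norm_num)
    obtain ⟨k, hk⟩ : ∃ k : ℝ, k = 2 ^ s / (36 * r) := ⟨_, rfl⟩
    have hk0 : 1 / (36 * r) ≤ k := by rw [hk]; gcongr
    have hk36 : 36 ≤ k := by
      refine le_trans ?_ hk0
      rw [le_div_iff₀ (by positivity)]
      linarith
    have hkpos : 0 < k := by linarith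
    have h2k : (2 : ℝ) ^ s = 36 * r * k := by rw [hk]; field_simp
    have hsx : x * (36 * r * k * (36 * r * k)) ≤ 2 * r := by
      rw [le_div_iff₀ (by positivity), h4s, h2k] at hs
      have : (x * (36 * r * k * (36 * r * k))) * T.card ≤ (2 * r) * T.card := by linarith
      exact le_of_mul_le_mul_right this hTpos
    have hkx : k ≤ 1 / x := by
      rw [le_div_iff₀ hx]
      have h1 : 648 * r * x * k ^ 2 ≤ 1 := by
        have : (648 * r * x * k ^ 2) * (2 * r) ≤ 1 * (2 * r) := by nlinarith
        exact le_of_mul_le_mul_right this (by positivity)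
      have h2 : (k * x) ^ 2 ≤ 1 := by
        refine le_trans ?_ h1
        have : x ≤ 648 * r := by linarith
        have h3 : 0 ≤ x * k ^ 2 := by positivity
        nlinarith
      nlinarith [mul_pos hkpos hx]
    have hIk : k ≤ I.card := by
      have : (36 * r * k) * (T.card : ℝ) ≤ (36 * r * I.card) * T.card := by
        rw [← h2k]; linarith
      have := le_of_mul_le_mul_right this hTpos
      exact le_of_mul_le_mul_left this (by positivity)
    have hCsize : ∀ b ∈ I, (T.card : ℝ) / (10368 * k ^ 2) ≤ (C b).card := by
      intro b hb
      refine le_trans ?_ (hC b hb).2.1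
      rw [h4s, h2k, div_div, div_le_div_iff₀ (by positivity) (by positivity)]
      have : r * (36 * r * k * (36 * r * k) * 8) ≤ r * (10368 * k ^ 2) := by
        have h1 : r * r ≤ 1 := by nlinarith
        have h2 : 0 ≤ r * k ^ 2 := by positivity
        nlinarith
      nlinarith
    have hsub : ∀ b ∈ I, (T.card : ℝ) / (41472 * k ^ 3) ≤ (C b).card / (4 * k) := by
      intro b hb
      rw [le_div_iff₀ (by positivity)]
      have heq : ∀ t : ℝ, t / (41472 * k ^ 3) * (4 * k) = t / (10368 * k ^ 2) := by
        intro t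
        field_simp
        ring
      exact (heq _).trans_le (hCsize b hb)
    have hspos : ∀ b ∈ I, (0 : ℝ) < (C b).card / (4 * k) := fun b hb =>
      lt_of_lt_of_le (div_pos hTpos (by positivity)) (hsub b hb)
    have hceil : (⌈k⌉₊ : ℝ) ≤ 2 * k := by
      have := Nat.ceil_lt_add_one hkpos.le
      linarith
    refine ⟨k, hk0, hkx, ?_⟩
    by_cases hall : ∀ b ∈ I, ∃ D ⊆ C b, CutConnected Gᶜ D ∧ (C b).card / (4 * k) ≤ (D.card : ℝ)
    · choose! D hDC hDcut hDcard using hall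
      have hDprop : ∀ b ∈ I, ∀ p ∈ D b, G.Adj b p ∧ G.Adj v p ∧
          ∀ b' ∈ I, b' ≠ b → Gᶜ.Adj p b' := by
        intro b hb p hp
        have hpC := hDC b hb hp
        have hpT := mem_nbrsIn.1 ((hC b hb).1 hpC)
        have hvp := hT p hpT.1
        refine ⟨hpT.2, hvp, fun b' hb' hne => ?_⟩
        have h1 := (hC b hb).2.2 b' hb' hne p hpC
        rw [SimpleGraph.compl_adj]
        refine ⟨?_, fun h => h1 h.symm⟩
        rintro rfl
        have := (hA p (hIA hb')).1
        rw [SimpleGraph.compl_adj] at this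
        exact this.2 hvp.symm
      let e := I.equivFin
      refine ⟨I.card, fun i => D (e.symm i), ?_, hIk, ?_, ?_⟩
      · intro i j hij
        rw [Finset.disjoint_left]
        intro p hp hp'
        have hne : ((e.symm j : I) : V) ≠ e.symm i := by
          intro h
          exact hij (e.symm.injective (Subtype.ext h.symm))
        have h1 := (hDprop _ (e.symm i).2 p hp).2.2 _ (e.symm j).2 hne
        rw [SimpleGraph.compl_adj] at h1
        exact h1.2 (hDprop _ (e.symm j).2 p hp').1.symm
      · intro i
        exact (hsub _ (e.symm i).2).trans (hDcard _ (e.symm i).2)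
      · have hone : ∀ b ∈ I, ∀ b' ∈ I, b' ≠ b → ∀ u ∈ D b',
            (∀ p ∈ D b, G.Adj p u) ∨ ∀ p ∈ D b, ¬ G.Adj p u := by
          intro b hb b' hb' hne u hu
          exact complete_or_anticomplete_to_vertex hG (hDcut b hb)
            (fun p hp => (hDprop b hb p hp).1) (fun p hp => (hDprop b hb p hp).2.1)
            (hA b (hIA hb)).1 ((hDprop b' hb' u hu).2.2 b hb hne.symm) (hDprop b' hb' u hu).2.1
        intro i j hij
        have hne : ((e.symm j : I) : V) ≠ e.symm i := by
          intro h
          exact hij (e.symm.injective (Subtype.ext h.symm))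
        exact completePair_or_anticompletePair
          (hone _ (e.symm i).2 _ (e.symm j).2 hne) (hone _ (e.symm j).2 _ (e.symm i).2 hne.symm)
    · push Not at hall
      obtain ⟨b, hb, hnoD⟩ := hall
      have hspos' := hspos b hb
      rcases exists_component_or_anticomplete Gᶜ hspos' ⌈k⌉₊ (C b) (by
        have h1 : 2 * ((C b).card / (4 * k)) * (⌈k⌉₊ : ℝ) ≤ 2 * ((C b).card / (4 * k)) * (2 * k) := by
          exact mul_le_mul_of_nonneg_left hceil (by linarith)
        have heq : ∀ t : ℝ, 2 * (t / (4 * k)) * (2 * k) = t := by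
          intro t
          field_simp
          ring
        exact h1.trans (heq _).le) with ⟨D, hDC, hDcut, hDs, -⟩ | ⟨B, hB, hBa, hBC⟩
      · exact absurd hDs (not_le.2 (hnoD D hDC hDcut))
      · exact ⟨⌈k⌉₊, B, hB, Nat.le_ceil k, fun i => (hsub b hb).trans (hBC i).2,
          fun i j hij => Or.inl (AnticompleteBlockade.complete_of_compl hB hBa i j hij)⟩
  · right
    refine ⟨T', hT'T, hT'c, fun a ha => (hT's a ha).trans ?_⟩
    nlinarith

theorem card_filter_lt_card_nbrsIn_le {G : SimpleGraph V} {S T : Finset V} {r q : ℝ}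
    (hT : T.Nonempty) (hS : ∀ t ∈ T, ((nbrsIn G t S).card : ℝ) ≤ q) :
    r * ((S.filter fun b => r * T.card < (nbrsIn G b T).card).card : ℝ) ≤ q := by
  have hTpos : (0 : ℝ) < T.card := by exact_mod_cast hT.card_pos
  set D := S.filter fun b => r * T.card < (nbrsIn G b T).card with hD
  have h1 : (D.card : ℝ) * (r * T.card) ≤ ∑ b ∈ D, ((nbrsIn G b T).card : ℝ) := by
    rw [← nsmul_eq_mul]
    exact Finset.card_nsmul_le_sum _ _ _ fun b hb => (Finset.mem_filter.1 hb).2.le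
  have h2 : ∑ b ∈ D, ((nbrsIn G b T).card : ℝ) ≤ ∑ b ∈ S, ((nbrsIn G b T).card : ℝ) :=
    Finset.sum_le_sum_of_subset_of_nonneg (Finset.filter_subset _ _)
      fun _ _ _ => Nat.cast_nonneg _
  have h3 : ∑ b ∈ S, ((nbrsIn G b T).card : ℝ) = ∑ t ∈ T, ((nbrsIn G t S).card : ℝ) := by
    exact_mod_cast sum_card_nbrsIn_comm G S T
  have h4 : ∑ t ∈ T, ((nbrsIn G t S).card : ℝ) ≤ T.card * q := by
    rw [← nsmul_eq_mul]
    exact Finset.sum_le_card_nsmul _ _ _ hS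
  have h5 : (r * D.card) * (T.card : ℝ) ≤ q * T.card := by linarith
  exact le_of_mul_le_mul_right h5 hTpos

theorem exists_sparseBlockade_of_step (G : SimpleGraph V) {x h w L : ℝ} (S : Finset V)
    (hw : 0 ≤ w)
    (hstep : ∀ S' ⊆ S, h ≤ (S'.card : ℝ) → ∃ T ⊆ S', ∃ R ⊆ S', Disjoint T R ∧
      L ≤ (T.card : ℝ) ∧ (S'.card : ℝ) ≤ R.card + w ∧ SparseTo G x T R) :
    ∀ (N : ℕ), ∀ S' ⊆ S, h + w * N ≤ (S'.card : ℝ) →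
      ∃ B : Fin N → Finset V, IsBlockade B ∧ SparseBlockade G x B ∧
        ∀ i, B i ⊆ S' ∧ L ≤ ((B i).card : ℝ) := by
  intro N
  induction N with
  | zero =>
    intro S' _ _
    exact ⟨fun i => i.elim0, fun i => i.elim0, fun i => i.elim0, fun i => i.elim0⟩
  | succ N ih =>
    intro S' hS' hcard
    push_cast at hcard
    have hN : 0 ≤ w * (N : ℝ) := mul_nonneg hw (Nat.cast_nonneg N)
    obtain ⟨T, hTS, R, hRS, hTR, hL, hRc, hsp⟩ := hstep S' hS' (by linarith)
    obtain ⟨B, hB, hBs, hBR⟩ := ih R (hRS.trans hS') (by linarith)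
    have hd : ∀ i, Disjoint T (B i) := fun i => Finset.disjoint_of_subset_right (hBR i).1 hTR
    refine ⟨Fin.cons T B, ?_, ?_, ?_⟩
    · intro i j hij
      cases i using Fin.cases with
      | zero =>
        cases j using Fin.cases with
        | zero => exact absurd rfl hij
        | succ j => simpa using hd j
      | succ i =>
        cases j using Fin.cases with
        | zero => simpa using (hd i).symm
        | succ j => simpa using hB i j (fun h => hij (by rw [h]))
    · intro i j hij
      cases j using Fin.cases with
      | zero => exact absurd hij (Fin.not_lt_zero i)
      | succ j =>
        cases i using Fin.cases with
        | zero =>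
          intro u hu
          have hu' : u ∈ B j := by simpa using hu
          simpa using hsp u ((hBR j).1 hu')
        | succ i => simpa using hBs i j (by simpa using hij)
    · intro i
      cases i using Fin.cases with
      | zero => exact ⟨by simpa using hTS, by simpa using hL⟩
      | succ i => exact ⟨by simpa using (hBR i).1.trans hRS, by simpa using (hBR i).2⟩

/-- From a sparse set we obtain a good blockade or a half of the set that is much sparser. -/
theorem SparseOn.exists_blockade_or_sparser {G : SimpleGraph V} (hG : Free P5ᶜ G) {x r : ℝ}
    (hx : 0 < x) (hr : 0 < r) (hr1 : r ≤ 1 / 1296) (hxr : x < 2 * r) (S : Finset V)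
    (hSn : S.Nonempty) (hS : SparseOn G S (r ^ 2)) :
    (∃ k : ℝ, 1 / (36 * r) ≤ k ∧ k ≤ 1 / x ∧ ∃ (n : ℕ) (B : Fin n → Finset V), IsBlockade B ∧
      k ≤ n ∧ (∀ i, r ^ 4 * S.card / 2 / (41472 * k ^ 3) ≤ ((B i).card : ℝ)) ∧
      PureBlockade G B) ∨
    (∃ (n : ℕ) (B : Fin n → Finset V), IsBlockade B ∧ 1 / (8 * r) ≤ n ∧
      (∀ i, r ^ 4 * S.card / 4 ≤ ((B i).card : ℝ)) ∧ SparseBlockade G x B) ∨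
    ∃ S' ⊆ S, (S.card : ℝ) / 2 ≤ S'.card ∧ SparseOn G S' (r ^ 4) := by
  by_contra hcon
  rw [not_or, not_or] at hcon
  obtain ⟨hpure, hsparse, hset⟩ := hcon
  have hm : (0 : ℝ) < S.card := by exact_mod_cast hSn.card_pos
  obtain ⟨m, hmdef⟩ : ∃ m : ℝ, m = S.card := ⟨_, rfl⟩
  rw [← hmdef] at hm hpure hsparse hset
  have hr4 : 0 < r ^ 4 := by positivity
  have hstep : ∀ S' ⊆ S, m / 2 ≤ (S'.card : ℝ) → ∃ T ⊆ S', ∃ R ⊆ S', Disjoint T R ∧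
      r ^ 4 * m / 4 ≤ (T.card : ℝ) ∧ (S'.card : ℝ) ≤ R.card + 2 * r * m ∧ SparseTo G x T R := by
    intro S' hS' hS'c
    have hnot : ¬ SparseOn G S' (r ^ 4) := fun h => hset ⟨S', hS', hS'c, h⟩
    unfold SparseOn at hnot
    push Not at hnot
    obtain ⟨v, hv, hvdeg⟩ := hnot
    obtain ⟨T, hTdef⟩ : ∃ T, T = nbrsIn G v S' := ⟨_, rfl⟩
    rw [← hTdef] at hvdeg
    have hTS' : T ⊆ S' := hTdef ▸ nbrsIn_subset _ _ _
    have hTadj : ∀ t ∈ T, G.Adj v t := fun t ht => (mem_nbrsIn.1 (hTdef ▸ ht)).2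
    have hTc : r ^ 4 * m / 2 ≤ T.card := by nlinarith
    have hTpos : (0 : ℝ) < T.card := lt_of_lt_of_le (by positivity) hTc
    have hTn : T.Nonempty := by
      rw [← Finset.card_pos]
      exact_mod_cast hTpos
    obtain ⟨A, hAdef⟩ : ∃ A, A = S'.filter fun b => Gᶜ.Adj b v ∧
      ((nbrsIn G b T).card : ℝ) ≤ r * T.card := ⟨_, rfl⟩
    have hA : ∀ b ∈ A, Gᶜ.Adj b v ∧ ((nbrsIn G b T).card : ℝ) ≤ r * T.card := by
      intro b hb
      rw [hAdef] at hb
      exact (Finset.mem_filter.1 hb).2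
    have hAS' : A ⊆ S' := hAdef ▸ Finset.filter_subset _ _
    rcases exists_pure_or_sparseTo hG hx hr hr1 hxr v T A hTn hTadj hA with
      ⟨k, hk0, hkx, n, B, hB, hkn, hBs, hBp⟩ | ⟨T', hT'T, hT'c, hT's⟩
    · exfalso
      refine hpure ⟨k, hk0, hkx, n, B, hB, hkn, fun i => le_trans ?_ (hBs i), hBp⟩
      have hk : 0 < k := lt_of_lt_of_le (by positivity) hk0
      exact div_le_div_of_nonneg_right hTc (by positivity)
    · refine ⟨T', hT'T.trans hTS', A, hAS', ?_, by linarith, ?_, hT's⟩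
      · rw [Finset.disjoint_left]
        intro t ht htA
        have h1 := (hA t htA).1
        rw [SimpleGraph.compl_adj] at h1
        exact h1.2 (hTadj t (hT'T ht)).symm
      · have hcover : S' ⊆ A ∪ (nbrsIn G v S ∪
            S.filter fun b => r * T.card < (nbrsIn G b T).card) := by
          intro b hb
          rw [Finset.mem_union, Finset.mem_union]
          by_cases hbad : r * T.card < (nbrsIn G b T).card
          · exact Or.inr (Or.inr (Finset.mem_filter.2 ⟨hS' hb, hbad⟩))
          · by_cases hbv : G.Adj v b
            · exact Or.inr (Or.inl (mem_nbrsIn.2 ⟨hS' hb, hbv⟩))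
            · left
              rw [hAdef, Finset.mem_filter]
              refine ⟨hb, ?_, not_lt.1 hbad⟩
              rw [SimpleGraph.compl_adj]
              refine ⟨?_, fun h => hbv h.symm⟩
              rintro rfl
              apply hbad
              have : nbrsIn G b T = T := by
                apply Finset.filter_true_of_mem
                exact hTadj
              rw [this]
              nlinarith
        have h1 : (S'.card : ℝ) ≤ A.card + ((nbrsIn G v S).card +
            (S.filter fun b => r * T.card < (nbrsIn G b T).card).card) := by
          have h2 := (Finset.card_le_card hcover).trans (Finset.card_union_le _ _)
          have h3 := Finset.card_union_le (nbrsIn G v S)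
            (S.filter fun b => r * T.card < (nbrsIn G b T).card)
          have := h2.trans (Nat.add_le_add_left h3 _)
          exact_mod_cast this
        have h2 : ((nbrsIn G v S).card : ℝ) ≤ r * m := by
          refine (hS v (hS' hv)).trans ?_
          rw [← hmdef]
          have : r ^ 2 ≤ r := by nlinarith
          exact mul_le_mul_of_nonneg_right this hm.le
        have h3 := card_filter_lt_card_nbrsIn_le (S := S) (r := r) hTn
          (fun t ht => hS t (hS' (hTS' ht)))
        rw [← hmdef, pow_two, mul_assoc] at h3
        have h4 := le_of_mul_le_mul_left h3 hr
        linarith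
  have hN1 : (⌊1 / (4 * r)⌋₊ : ℝ) ≤ 1 / (4 * r) := Nat.floor_le (by positivity)
  have hN2 : 1 / (4 * r) < (⌊1 / (4 * r)⌋₊ : ℝ) + 1 := Nat.lt_floor_add_one _
  obtain ⟨B, hB, hBs, hBS⟩ := exists_sparseBlockade_of_step G S (by positivity) hstep
    ⌊1 / (4 * r)⌋₊ S subset_rfl (by
      have h1 : 2 * r * m * (⌊1 / (4 * r)⌋₊ : ℝ) ≤ 2 * r * m * (1 / (4 * r)) :=
        mul_le_mul_of_nonneg_left hN1 (by positivity)
      have h2 : 2 * r * m * (1 / (4 * r)) = m / 2 := by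
        field_simp
        norm_num
      rw [← hmdef]
      linarith)
  refine hsparse ⟨_, B, hB, ?_, fun i => (hBS i).2, hBs⟩
  have h1 : 1 / (4 * r) = 2 * (1 / (8 * r)) := by
    field_simp
    norm_num
  have h2 : 1 ≤ 1 / (8 * r) := by
    rw [le_div_iff₀ (by positivity)]
    linarith
  linarith

/-- A pure or `x`-sparse blockade of length at least `k` with blocks of size at least `M / k ^ d`,
for some `k` between `2` and `1 / x`. -/
def HasPureOrSparseBlockade (G : SimpleGraph V) (x M : ℝ) (d : ℕ) : Prop :=
  ∃ k : ℝ, 2 ≤ k ∧ k ≤ 1 / x ∧ ∃ (n : ℕ) (B : Fin n → Finset V), IsBlockade B ∧ k ≤ n ∧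
    (∀ i, M / k ^ d ≤ ((B i).card : ℝ)) ∧ (PureBlockade G B ∨ SparseBlockade G x B)

theorem SparseOn.hasPureOrSparseBlockade_of_large {G : SimpleGraph V} {x M : ℝ} {c d : ℕ}
    (hx : 0 < x) (hx1 : x ≤ 1 / 4) (hd : 8 * c + 2 ≤ d) (hM : 1 / x ^ d ≤ M) (S : Finset V)
    (hS : SparseOn G S (x ^ 2 / 4)) (hSM : x ^ (8 * c) * M ≤ S.card) :
    HasPureOrSparseBlockade G x M d := by
  obtain ⟨m, hm⟩ : ∃ m : ℝ, m = S.card := ⟨_, rfl⟩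
  rw [← hm] at hSM
  have hMpos : 0 < M := lt_of_lt_of_le (by positivity) hM
  have hxd : x ^ d ≤ x ^ (8 * c) * x ^ 2 := by
    rw [← pow_add]
    exact pow_le_pow_of_le_one hx.le (by linarith) hd
  have hMx : 1 ≤ M * x ^ d := by rwa [div_le_iff₀ (by positivity)] at hM
  have hmx : 4 * (M * x ^ d) ≤ m * x := by
    have h1 : M * x ^ d ≤ M * (x ^ (8 * c) * x ^ 2) := mul_le_mul_of_nonneg_left hxd hMpos.le
    have h2 : M * (x ^ (8 * c) * x ^ 2) ≤ m * x ^ 2 := by nlinarith [sq_nonneg x]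
    have hm0 : 0 ≤ m := hm ▸ Nat.cast_nonneg _
    have h3 : m * x ^ 2 ≤ m * x / 4 := by nlinarith [mul_nonneg hm0 hx.le]
    linarith
  have hk4 : 4 ≤ 1 / x := by
    rw [le_div_iff₀ hx]
    linarith
  obtain ⟨N, hN⟩ : ∃ N : ℕ, N = ⌈1 / x⌉₊ := ⟨_, rfl⟩
  have hN1 : 1 / x ≤ N := hN ▸ Nat.le_ceil _
  have hN2 : (N : ℝ) ≤ 2 / x := by
    have h1 : (N : ℝ) < 1 / x + 1 := hN ▸ Nat.ceil_lt_add_one (by positivity)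
    have h2 : 2 / x = 1 / x + 1 / x := by ring
    linarith
  have hNpos : (0 : ℝ) < N := by linarith
  obtain ⟨q, hq⟩ : ∃ q : ℕ, q = ⌊m / N⌋₊ := ⟨_, rfl⟩
  have hmN : m * x / 2 ≤ m / N := by
    rw [le_div_iff₀ hNpos]
    have h1 : (N : ℝ) * x ≤ 2 := by rwa [le_div_iff₀ hx] at hN2
    have hm0 : 0 ≤ m := hm ▸ Nat.cast_nonneg _
    nlinarith
  have hq1 : m * x / 4 ≤ q := by
    have h1 : m / N < q + 1 := hq ▸ Nat.lt_floor_add_one _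
    linarith
  have hq2 : (N : ℝ) * q ≤ m := by
    have h1 : (q : ℝ) ≤ m / N := hq ▸ Nat.floor_le (by
      have : (0 : ℝ) ≤ m := hm ▸ Nat.cast_nonneg _
      positivity)
    rw [le_div_iff₀ hNpos] at h1
    linarith
  obtain ⟨B, hB, hBS⟩ := exists_disjoint_subsets_card_eq q N S (by
    rw [hm] at hq2
    exact_mod_cast hq2)
  refine ⟨1 / x, by linarith, le_rfl, N, B, hB, hN1, ?_, Or.inr ?_⟩
  · intro i
    rw [(hBS i).2, div_pow, one_pow, div_div_eq_mul_div, div_one]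
    linarith
  · intro i j _ u hu
    have h1 : ((nbrsIn G u (B i)).card : ℝ) ≤ (nbrsIn G u S).card := by
      exact_mod_cast Finset.card_le_card (nbrsIn_mono G u (hBS i).1)
    have h2 := hS u ((hBS j).1 hu)
    rw [← hm] at h2
    rw [(hBS i).2]
    nlinarith

theorem SparseOn.hasPureOrSparseBlockade_aux {G : SimpleGraph V} (hG : Free P5ᶜ G) {x M : ℝ}
    {c d : ℕ} (hx : 0 < x) (hx1 : x ≤ 1 / 4) (hc : 1 ≤ c) (hd : 8 * c + 40 ≤ d)
    (hM : 1 / x ^ d ≤ M) :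
    ∀ (j : ℕ) (r : ℝ) (S : Finset V), 0 < r → r ≤ 1 / 1296 → SparseOn G S (r ^ 2) →
      r ^ (2 * c) * M ≤ S.card → x < 2 * r → r ^ (2 ^ j) ≤ x / 2 →
      HasPureOrSparseBlockade G x M d := by
  have hMpos : 0 < M := lt_of_lt_of_le (by positivity) hM
  intro j
  induction j with
  | zero =>
    intro r S _ _ _ _ h1 h2
    rw [pow_zero, pow_one] at h2
    linarith
  | succ j ih =>
    intro r S hr hr1 hS hSM hxr hj
    have hrc : 0 < r ^ (2 * c) := by positivity
    have hSpos : (0 : ℝ) < S.card := lt_of_lt_of_le (by positivity) hSM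
    have hSn : S.Nonempty := by
      rw [← Finset.card_pos]
      exact_mod_cast hSpos
    have hSM4 : r ^ (2 * c + 4) * M ≤ r ^ 4 * S.card := by
      rw [pow_add]
      nlinarith [pow_pos hr 4]
    rcases hS.exists_blockade_or_sparser hG hx hr hr1 hxr S hSn with
      ⟨k, hk0, hkx, n, B, hB, hkn, hBs, hBp⟩ | ⟨n, B, hB, hkn, hBs, hBx⟩ | ⟨S', -, hS'c, hS'⟩
    · have hkr : 1 ≤ k * (36 * r) := by rwa [div_le_iff₀ (by positivity)] at hk0
      have hk36 : 36 ≤ k := by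
        have : k * (36 * r) * 36 ≤ k := by nlinarith [mul_nonneg (show 0 ≤ k by nlinarith) hr.le]
        linarith
      have hkpos : 0 < k := by linarith
      have hrk : 1 ≤ r * k ^ 2 := by nlinarith [mul_pos hkpos hr]
      refine ⟨k, by linarith, hkx, n, B, hB, hkn, fun i => le_trans ?_ (hBs i), Or.inl hBp⟩
      have h1 : M / k ^ d ≤ r ^ (2 * c + 4) * M / 2 / (41472 * k ^ 3) := by
        rw [div_div, div_le_div_iff₀ (by positivity) (by positivity)]
        have h2 : 82944 * k ^ 3 ≤ r ^ (2 * c + 4) * k ^ d := by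
          have h3 : k ^ 3 * k ^ 4 * (k ^ 2) ^ (2 * c + 4) ≤ k ^ d := by
            rw [← pow_mul, ← pow_add, ← pow_add]
            exact pow_le_pow_right₀ (by linarith) (by omega)
          have h4 : 1 ≤ r ^ (2 * c + 4) * (k ^ 2) ^ (2 * c + 4) := by
            rw [← mul_pow]
            exact one_le_pow₀ hrk
          have h5 : (82944 : ℝ) ≤ k ^ 4 := by
            calc (82944 : ℝ) ≤ 36 ^ 4 := by norm_num
              _ ≤ k ^ 4 := by gcongr
          calc 82944 * k ^ 3 ≤ k ^ 4 * k ^ 3 * 1 := by nlinarith [pow_pos hkpos 3]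
            _ ≤ k ^ 4 * k ^ 3 * (r ^ (2 * c + 4) * (k ^ 2) ^ (2 * c + 4)) := by gcongr
            _ = r ^ (2 * c + 4) * (k ^ 3 * k ^ 4 * (k ^ 2) ^ (2 * c + 4)) := by ring
            _ ≤ r ^ (2 * c + 4) * k ^ d := by gcongr
        nlinarith
      refine h1.trans ?_
      gcongr
    · refine ⟨1 / (8 * r), ?_, ?_, n, B, hB, hkn, fun i => le_trans ?_ (hBs i), Or.inr hBx⟩
      · rw [le_div_iff₀ (by positivity)]
        linarith
      · gcongr
        linarith
      · rw [div_pow, one_pow, div_div_eq_mul_div, div_one]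
        have h1 : (8 * r) ^ d ≤ (8 * r) ^ (2 * (2 * c + 5)) :=
          pow_le_pow_of_le_one (by positivity) (by linarith) (by omega)
        have h2 : (8 * r) ^ (2 * (2 * c + 5)) ≤ r ^ (2 * c + 5) := by
          rw [pow_mul]
          gcongr
          nlinarith
        have h3 : r ^ (2 * c + 5) ≤ r ^ (2 * c + 4) / 4 := by
          rw [pow_succ r (2 * c + 4)]
          nlinarith [pow_pos hr (2 * c + 4)]
        nlinarith
    · have hS'M : (r ^ 2) ^ (2 * c) * M ≤ S'.card := by
        have h1 : r ^ (2 * c) ≤ 1 / 2 := by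
          calc r ^ (2 * c) ≤ r ^ 1 := pow_le_pow_of_le_one hr.le (by linarith) (by omega)
            _ ≤ 1 / 2 := by linarith
        rw [pow_right_comm, pow_two]
        nlinarith [mul_pos hrc hMpos]
      have hr2 : 0 < r ^ 2 := by positivity
      by_cases hcase : x < 2 * r ^ 2
      · refine ih (r ^ 2) S' hr2 (by nlinarith) (by rwa [← pow_mul]) hS'M hcase ?_
        rw [← pow_mul, ← pow_succ']
        exact hj
      · push Not at hcase
        refine SparseOn.hasPureOrSparseBlockade_of_large (c := c) hx hx1 (by omega) hM S' ?_ ?_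
        · intro u hu
          refine (hS' u hu).trans ?_
          gcongr
          nlinarith
        · refine le_trans ?_ hS'M
          gcongr
          have h1 : x ^ 4 ≤ r ^ 2 := by
            have h2 : x ^ 2 ≤ r := by nlinarith
            calc x ^ 4 = (x ^ 2) ^ 2 := by ring
              _ ≤ r ^ 2 := by gcongr
          calc x ^ (8 * c) = (x ^ 4) ^ (2 * c) := by rw [← pow_mul]; congr 1; ring
            _ ≤ (r ^ 2) ^ (2 * c) := by gcongr

theorem SparseOn.hasPureOrSparseBlockade {G : SimpleGraph V} (hG : Free P5ᶜ G) {x M : ℝ}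
    {c d : ℕ} (hx : 0 < x) (hx1 : x ≤ 1 / 1296) (hc : 1 ≤ c) (hd : 8 * c + 40 ≤ d)
    (hM : 1 / x ^ d ≤ M) (S : Finset V) (hS : SparseOn G S ((1 / 1296) ^ 2))
    (hSM : (1 / 1296) ^ (2 * c) * M ≤ S.card) : HasPureOrSparseBlockade G x M d := by
  obtain ⟨j, hj⟩ := exists_pow_lt_of_lt_one (show 0 < x / 2 by positivity)
    (show (1 / 1296 : ℝ) < 1 by norm_num)
  refine SparseOn.hasPureOrSparseBlockade_aux hG hx (by linarith) hc hd hM j (1 / 1296) S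
    (by norm_num) le_rfl hS hSM (by linarith) ?_
  refine le_trans ?_ hj.le
  exact pow_le_pow_of_le_one (by norm_num) (by norm_num) Nat.lt_two_pow_self.le

/-- A house-free graph with very sparse complement has two large sets complete to each other. -/
theorem SparseOn.exists_completeBlockade {G : SimpleGraph V} (hG : Free P5ᶜ G) (S : Finset V)
    (hSc : 1000 ≤ (S.card : ℝ)) (hS : SparseOn Gᶜ S (1 / 1000)) :
    ∃ B : Fin 2 → Finset V, IsBlockade B ∧ CompleteBlockade G B ∧
      ∀ i, (S.card : ℝ) / 100 ≤ (B i).card := by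
  by_contra hcon
  obtain ⟨m, hm⟩ : ∃ m : ℝ, m = S.card := ⟨_, rfl⟩
  rw [← hm] at hSc hcon
  have hcomp : ∀ W ⊆ S, m / 25 ≤ (W.card : ℝ) → ∃ D ⊆ W, CutConnected Gᶜ D ∧
      (W.card : ℝ) / 4 ≤ D.card ∧ AnticompletePair Gᶜ D (W \ D) := by
    intro W _ hW
    rcases exists_component_or_anticomplete Gᶜ (s := (W.card : ℝ) / 4) (by linarith) 2 W
      (by push_cast; linarith) with h | ⟨B, hB, hBa, hBW⟩
    · exact h
    · exact absurd ⟨B, hB, AnticompleteBlockade.complete_of_compl hB hBa,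
        fun i => by linarith [(hBW i).2]⟩ hcon
  have hdeg : ∀ v ∈ S, ∀ W ⊆ S, ((nbrsIn Gᶜ v W).card : ℝ) ≤ m / 1000 := by
    intro v hv W hW
    have h1 : ((nbrsIn Gᶜ v W).card : ℝ) ≤ (nbrsIn Gᶜ v S).card := by
      exact_mod_cast Finset.card_le_card (nbrsIn_mono Gᶜ v hW)
    have h2 := hS v hv
    rw [← hm] at h2
    linarith
  obtain ⟨D, hDS, hD, hDc, -⟩ := hcomp S subset_rfl (by rw [← hm]; linarith)
  rw [← hm] at hDc
  obtain ⟨v, hv⟩ : D.Nonempty := by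
    rw [← Finset.card_pos]
    have : (0 : ℝ) < D.card := by linarith
    exact_mod_cast this
  obtain ⟨W, hW⟩ : ∃ W, W = D \ insert v (nbrsIn Gᶜ v D) := ⟨_, rfl⟩
  have hWD : W ⊆ D := hW ▸ Finset.sdiff_subset
  have hWmem : ∀ u, u ∈ W ↔ u ∈ D ∧ u ≠ v ∧ ¬ Gᶜ.Adj v u := by
    intro u
    rw [hW, Finset.mem_sdiff, Finset.mem_insert, mem_nbrsIn]
    tauto
  have hWc : m / 5 ≤ W.card := by
    have h1 : (D.card : ℝ) ≤ W.card + (insert v (nbrsIn Gᶜ v D)).card := by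
      rw [hW]
      exact_mod_cast Finset.card_le_card_sdiff_add_card
    have h2 : ((insert v (nbrsIn Gᶜ v D)).card : ℝ) ≤ (nbrsIn Gᶜ v D).card + 1 := by
      exact_mod_cast Finset.card_insert_le _ _
    linarith [hdeg v (hDS hv) D hDS]
  obtain ⟨E, hEW, hE, hEc, hEa⟩ := hcomp W (hWD.trans hDS) (by linarith)
  have hEn : E.Nonempty := by
    rw [← Finset.card_pos]
    have : (0 : ℝ) < E.card := by linarith
    exact_mod_cast this
  obtain ⟨y, hy, w, hw, hyw⟩ := hD E (hEW.trans hWD) hEn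
    ⟨v, Finset.mem_sdiff.2 ⟨hv, fun h => ((hWmem v).1 (hEW h)).2.1 rfl⟩⟩
  rw [Finset.mem_sdiff] at hw
  have hvw : Gᶜ.Adj v w := by
    by_contra hvw
    have hne : w ≠ v := by
      rintro rfl
      exact ((hWmem y).1 (hEW hy)).2.2 hyw.symm
    exact hEa y hy w (Finset.mem_sdiff.2 ⟨(hWmem w).2 ⟨hw.1, hne, hvw⟩, hw.2⟩) hyw
  obtain ⟨X, hX⟩ : ∃ X, X = E \ nbrsIn Gᶜ w E := ⟨_, rfl⟩
  have hXE : X ⊆ E := hX ▸ Finset.sdiff_subset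
  have hES : E ⊆ S := hEW.trans (hWD.trans hDS)
  have hXmem : ∀ u, u ∈ X ↔ u ∈ E ∧ ¬ Gᶜ.Adj w u := by
    intro u
    rw [hX, Finset.mem_sdiff, mem_nbrsIn]
    tauto
  have hXc : m / 25 ≤ X.card := by
    have h1 : (E.card : ℝ) ≤ X.card + (nbrsIn Gᶜ w E).card := by
      rw [hX]
      exact_mod_cast Finset.card_le_card_sdiff_add_card
    linarith [hdeg w (hDS hw.1) E hES]
  obtain ⟨F, hFX, hF, hFc, hFa⟩ := hcomp X (hXE.trans hES) hXc
  have hFn : F.Nonempty := by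
    rw [← Finset.card_pos]
    have : (0 : ℝ) < F.card := by linarith
    exact_mod_cast this
  obtain ⟨d0, hd0, c, hc, hdc⟩ := hE F (hFX.trans hXE) hFn
    ⟨y, Finset.mem_sdiff.2 ⟨hy, fun h => ((hXmem y).1 (hFX h)).2 hyw.symm⟩⟩
  rw [Finset.mem_sdiff] at hc
  have hwc : Gᶜ.Adj w c := by
    by_contra hwc
    exact hFa d0 hd0 c (Finset.mem_sdiff.2 ⟨(hXmem c).2 ⟨hc.1, hwc⟩, hc.2⟩) hdc
  have hFS : F ⊆ S := hFX.trans (hXE.trans hES)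
  have hrest : (F \ nbrsIn Gᶜ c F).Nonempty := by
    rw [← Finset.card_pos]
    have h1 : (F.card : ℝ) ≤ (F \ nbrsIn Gᶜ c F).card + (nbrsIn Gᶜ c F).card := by
      exact_mod_cast Finset.card_le_card_sdiff_add_card
    have h2 : (0 : ℝ) < (F \ nbrsIn Gᶜ c F).card := by
      linarith [hdeg c (hES hc.1) F hFS]
    exact_mod_cast h2
  obtain ⟨p, hp, q, hq, hpq⟩ := hF (nbrsIn Gᶜ c F) (nbrsIn_subset _ _ _)
    ⟨d0, mem_nbrsIn.2 ⟨hd0, hdc.symm⟩⟩ hrest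
  rw [mem_nbrsIn] at hp
  rw [Finset.mem_sdiff, mem_nbrsIn] at hq
  have hFprop : ∀ u ∈ F, ¬ Gᶜ.Adj v u ∧ ¬ Gᶜ.Adj w u := fun u hu =>
    ⟨((hWmem u).1 (hEW (hXE (hFX hu)))).2.2, ((hXmem u).1 (hFX hu)).2⟩
  exact no_path_compl hG hvw hwc hp.2 hpq ((hWmem c).1 (hEW hc.1)).2.2
    (hFprop p hp.1).1 (hFprop q hq.1).1 (hFprop p hp.1).2 (hFprop q hq.1).2
    (fun h => hq.2 ⟨hq.1, h⟩)

/-- Given `h` large sets, either they contain a partite copy of a given `h`-vertex graph, or two of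
them contain large subsets with a very sparse or very dense pair. -/
theorem exists_partite_copy_or_sparseTo {ε : ℝ} (hε : 0 < ε) :
    ∀ h : ℕ, ∃ δ : ℝ, 0 < δ ∧ ∀ (V : Type) (G : SimpleGraph V) (H : SimpleGraph (Fin h))
      (P : Fin h → Finset V) (s : ℝ), 0 < s → (∀ i, s ≤ ((P i).card : ℝ)) →
      (∃ f : Fin h → V, (∀ i, f i ∈ P i) ∧ ∀ i j, H.Adj i j ↔ G.Adj (f i) (f j)) ∨
      ∃ i j : Fin h, i ≠ j ∧ ∃ A ⊆ P i, ∃ B ⊆ P j, δ * s ≤ (A.card : ℝ) ∧ δ * s ≤ (B.card : ℝ) ∧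
        (SparseTo G ε B A ∨ SparseTo Gᶜ ε B A) := by
  intro h
  induction h with
  | zero => exact ⟨1, one_pos, fun V G H P s _ _ => Or.inl ⟨fun i => i.elim0, fun i => i.elim0,
      fun i => i.elim0⟩⟩
  | succ h ih =>
    obtain ⟨δ, hδ, ih⟩ := ih
    have hh : (0 : ℝ) < h + 1 := by positivity
    refine ⟨min (δ * ε) (1 / (h + 1)), by positivity, ?_⟩
    intro V G H P s hs hP
    have hδ1 : min (δ * ε) (1 / ((h : ℝ) + 1)) * s ≤ s / (h + 1) := by
      calc min (δ * ε) (1 / ((h : ℝ) + 1)) * s ≤ 1 / (h + 1) * s := by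
            gcongr
            exact min_le_right _ _
        _ = s / (h + 1) := by ring
    have hδ2 : min (δ * ε) (1 / ((h : ℝ) + 1)) * s ≤ δ * (ε * s) := by
      rw [← mul_assoc]
      gcongr
      exact min_le_left _ _
    have hδ3 : s / ((h : ℝ) + 1) ≤ s := by
      rw [div_le_iff₀ hh]
      nlinarith [mul_nonneg hs.le (Nat.cast_nonneg h : (0 : ℝ) ≤ h)]
    let Γ : Fin h → SimpleGraph V := fun j => if H.Adj 0 j.succ then G else Gᶜ
    let Bad : Fin h → Finset V := fun j => (P 0).filter fun v =>
      ((nbrsIn (Γ j) v (P j.succ)).card : ℝ) ≤ ε * (P j.succ).card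
    by_cases hbad : ∃ j, s / (h + 1) ≤ ((Bad j).card : ℝ)
    · obtain ⟨j, hj⟩ := hbad
      right
      refine ⟨0, j.succ, (Fin.succ_ne_zero j).symm, Bad j, Finset.filter_subset _ _, P j.succ,
        subset_rfl, hδ1.trans hj, hδ1.trans (hδ3.trans (hP _)), ?_⟩
      have hsp : SparseTo (Γ j) ε (P j.succ) (Bad j) := fun v hv => (Finset.mem_filter.1 hv).2
      by_cases hadj : H.Adj 0 j.succ
      · left
        simpa only [Γ, if_pos hadj] using hsp
      · right
        simpa only [Γ, if_neg hadj] using hsp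
    · push Not at hbad
      have hex : ∃ v ∈ P 0, v ∉ Finset.univ.biUnion Bad := by
        by_contra hcon
        push Not at hcon
        have h1 : (P 0).card ≤ ∑ j, (Bad j).card :=
          (Finset.card_le_card hcon).trans Finset.card_biUnion_le
        have h2 : ∑ j, ((Bad j).card : ℝ) ≤ ∑ _j : Fin h, s / (h + 1) :=
          Finset.sum_le_sum fun j _ => (hbad j).le
        rw [Finset.sum_const, Finset.card_univ, Fintype.card_fin, nsmul_eq_mul] at h2
        have h3 : ((P 0).card : ℝ) ≤ ∑ j, ((Bad j).card : ℝ) := by exact_mod_cast h1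
        have h4 : (h : ℝ) * (s / (h + 1)) < s := by
          rw [mul_div_assoc', div_lt_iff₀ hh]
          linarith
        linarith [hP 0]
      obtain ⟨v, hv, hvbad⟩ := hex
      have hgood : ∀ j, ε * s ≤ ((nbrsIn (Γ j) v (P j.succ)).card : ℝ) := by
        intro j
        have h1 : v ∉ Bad j := fun h => hvbad (Finset.mem_biUnion.2 ⟨j, Finset.mem_univ _, h⟩)
        have h2 : ε * (P j.succ).card < ((nbrsIn (Γ j) v (P j.succ)).card : ℝ) := by
          by_contra hcon
          exact h1 (Finset.mem_filter.2 ⟨hv, not_lt.1 hcon⟩)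
        have h3 := mul_le_mul_of_nonneg_left (hP j.succ) hε.le
        linarith
      rcases ih V G (H.comap Fin.succ) (fun j => nbrsIn (Γ j) v (P j.succ)) (ε * s)
        (by positivity) hgood with ⟨f, hfP, hf⟩ | ⟨i, j, hij, A, hA, B, hB, hAc, hBc, hAB⟩
      · left
        have h0 : ∀ j : Fin h, H.Adj 0 j.succ ↔ G.Adj v (f j) := by
          intro j
          have h1 := (mem_nbrsIn.1 (hfP j)).2
          by_cases hadj : H.Adj 0 j.succ
          · simp only [Γ, if_pos hadj] at h1
            exact ⟨fun _ => h1, fun _ => hadj⟩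
          · simp only [Γ, if_neg hadj, SimpleGraph.compl_adj] at h1
            exact ⟨fun h => absurd h hadj, fun h => absurd h h1.2⟩
        refine ⟨Fin.cons v f, ?_, ?_⟩
        · intro i
          cases i using Fin.cases with
          | zero => simpa using hv
          | succ i => simpa using (mem_nbrsIn.1 (hfP i)).1
        · intro i j
          cases i using Fin.cases with
          | zero =>
            cases j using Fin.cases with
            | zero => simp
            | succ j => simpa using h0 j
          | succ i =>
            cases j using Fin.cases with
            | zero => simpa [SimpleGraph.adj_comm] using h0 i
            | succ j => simpa using hf i j
      · right
        exact ⟨i.succ, j.succ, fun h => hij (Fin.succ_injective _ h), A,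
          hA.trans (nbrsIn_subset _ _ _), B, hB.trans (nbrsIn_subset _ _ _),
          hδ2.trans hAc, hδ2.trans hBc, hAB⟩

theorem exists_disjoint_sparseTo {ε : ℝ} (hε : 0 < ε) :
    ∃ δ : ℝ, 0 < δ ∧ ∀ (V : Type) (G : SimpleGraph V), Free P5ᶜ G → ∀ W : Finset V, 5 ≤ W.card →
      ∃ A ⊆ W, ∃ B ⊆ W, Disjoint A B ∧ δ * W.card ≤ (A.card : ℝ) ∧ δ * W.card ≤ (B.card : ℝ) ∧
        (SparseTo G ε B A ∨ SparseTo Gᶜ ε B A) := by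
  obtain ⟨δ, hδ, h⟩ := exists_partite_copy_or_sparseTo hε 5
  refine ⟨δ / 10, by positivity, ?_⟩
  intro V G hG W hW
  obtain ⟨P, hP, hPW⟩ := exists_disjoint_subsets_card_eq (W.card / 5) 5 W (by omega)
  have hs : (W.card : ℝ) / 10 ≤ (W.card / 5 : ℕ) := by
    have h1 : W.card ≤ 10 * (W.card / 5) := by omega
    have h2 : (W.card : ℝ) ≤ 10 * (W.card / 5 : ℕ) := by exact_mod_cast h1
    linarith
  have hWpos : (0 : ℝ) < W.card := by
    have : 0 < W.card := by omega
    exact_mod_cast this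
  rcases h V G P5ᶜ P (W.card / 10) (by positivity) (fun i => by rw [(hPW i).2]; exact hs) with
    ⟨f, hfP, hf⟩ | ⟨i, j, hij, A, hA, B, hB, hAc, hBc, hAB⟩
  · refine absurd ⟨f, ?_, hf⟩ hG
    intro i j hij
    by_contra hne
    exact Finset.disjoint_left.1 (hP i j hne) (hfP i) (hij ▸ hfP j)
  · exact ⟨A, hA.trans (hPW i).1, B, hB.trans (hPW j).1,
      Finset.disjoint_of_subset_left hA (Finset.disjoint_of_subset_right hB (hP i j hij)),
      by linarith, by linarith, hAB⟩

theorem card_nbrsIn_union_le (G : SimpleGraph V) (v : V) (A B : Finset V) :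
    (nbrsIn G v (A ∪ B)).card ≤ (nbrsIn G v A).card + (nbrsIn G v B).card := by
  unfold nbrsIn
  rw [Finset.filter_union]
  exact Finset.card_union_le _ _

/-- A set with few edges inside `A` extends by a subset of `B` when `A` is sparse to `B`. -/
theorem SparseTo.exists_extension {G : SimpleGraph V} {ε : ℝ} (hε : 0 < ε) {A B U : Finset V}
    (hAB : Disjoint A B) (h : SparseTo G ε B A) (hUA : U ⊆ A) {p s : ℕ} (hU : U.card = p * s)
    (hUe : ∑ u ∈ U, ((nbrsIn G u U).card : ℝ) ≤ p * s ^ 2 + 2 * ε * (p * s) ^ 2)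
    (hs : 2 * (s : ℝ) ≤ B.card) :
    ∃ T ⊆ A ∪ B, T.card = (p + 1) * s ∧ ∑ u ∈ T, ((nbrsIn G u T).card : ℝ) ≤
      (p + 1 : ℕ) * s ^ 2 + 2 * ε * ((p + 1 : ℕ) * s) ^ 2 := by
  obtain ⟨C, hC⟩ : ∃ C, C = B.filter fun b => ((nbrsIn G b U).card : ℝ) ≤ 2 * ε * U.card :=
    ⟨_, rfl⟩
  have hCB : C ⊆ B := hC ▸ Finset.filter_subset _ _
  have hCc : (s : ℝ) ≤ C.card := by
    rcases U.eq_empty_or_nonempty with rfl | hUn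
    · have : C = B := by
        rw [hC]
        apply Finset.filter_true_of_mem
        intro b _
        simp [nbrsIn]
      rw [this]
      linarith [(Nat.cast_nonneg s : (0 : ℝ) ≤ s)]
    · have h1 := card_filter_lt_card_nbrsIn_le (S := B) (r := 2 * ε) hUn
        (fun t ht => h t (hUA ht))
      have h2 : (C.card : ℝ) + (B.filter fun b => 2 * ε * U.card < (nbrsIn G b U).card).card =
          B.card := by
        have h3 := Finset.card_filter_add_card_filter_not (s := B)
          (fun b => ((nbrsIn G b U).card : ℝ) ≤ 2 * ε * U.card)
        simp only [not_le] at h3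
        rw [hC]
        exact_mod_cast h3
      have h3 : ε * (2 * ((B.filter fun b => 2 * ε * U.card < (nbrsIn G b U).card).card : ℝ)) ≤
          ε * B.card := by linarith
      have h4 := le_of_mul_le_mul_left h3 hε
      linarith
  obtain ⟨D, hDC, hDs⟩ := Finset.exists_subset_card_eq (show s ≤ C.card by exact_mod_cast hCc)
  have hUD : Disjoint U D :=
    Finset.disjoint_of_subset_left hUA (Finset.disjoint_of_subset_right (hDC.trans hCB) hAB)
  refine ⟨U ∪ D, Finset.union_subset_union hUA (hDC.trans hCB), ?_, ?_⟩
  · rw [Finset.card_union_of_disjoint hUD, hU, hDs]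
    ring
  · have hDU : ∑ b ∈ D, ((nbrsIn G b U).card : ℝ) ≤ s * (2 * ε * (p * s)) := by
      have h1 := Finset.sum_le_card_nsmul D (fun b => ((nbrsIn G b U).card : ℝ))
        (2 * ε * U.card) (fun b hb => by
          have := hDC hb
          rw [hC] at this
          exact (Finset.mem_filter.1 this).2)
      rw [nsmul_eq_mul, hDs, hU] at h1
      push_cast at h1
      exact h1
    have hUD' : ∑ u ∈ U, ((nbrsIn G u D).card : ℝ) = ∑ b ∈ D, ((nbrsIn G b U).card : ℝ) := by
      exact_mod_cast sum_card_nbrsIn_comm G U D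
    have hDD : ∑ b ∈ D, ((nbrsIn G b D).card : ℝ) ≤ s * s := by
      have h1 := Finset.sum_le_card_nsmul D (fun b => ((nbrsIn G b D).card : ℝ)) (s : ℝ)
        (fun b _ => by
          rw [← hDs]
          exact_mod_cast Finset.card_le_card (nbrsIn_subset _ _ _))
      rw [nsmul_eq_mul, hDs] at h1
      exact h1
    have hsplit : ∀ X : Finset V, ∑ u ∈ X, ((nbrsIn G u (U ∪ D)).card : ℝ) ≤
        ∑ u ∈ X, ((nbrsIn G u U).card : ℝ) + ∑ u ∈ X, ((nbrsIn G u D).card : ℝ) := by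
      intro X
      rw [← Finset.sum_add_distrib]
      refine Finset.sum_le_sum fun u _ => ?_
      exact_mod_cast card_nbrsIn_union_le G u U D
    rw [Finset.sum_union hUD]
    have h1 := hsplit U
    have h2 := hsplit D
    have h3 : 0 ≤ ε * (s : ℝ) ^ 2 := by positivity
    push_cast
    nlinarith

theorem exists_few_edges {ε : ℝ} (hε : 0 < ε) :
    ∀ N p q : ℕ, p + q = N → ∃ δ : ℝ, 0 < δ ∧ ∀ (V : Type) (G : SimpleGraph V), Free P5ᶜ G →
      ∀ (W : Finset V) (s : ℕ), 1 ≤ s → (s : ℝ) ≤ δ * W.card → ∃ U ⊆ W,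
        (U.card = p * s ∧
          ∑ u ∈ U, ((nbrsIn G u U).card : ℝ) ≤ p * s ^ 2 + 2 * ε * (p * s) ^ 2) ∨
        (U.card = q * s ∧
          ∑ u ∈ U, ((nbrsIn Gᶜ u U).card : ℝ) ≤ q * s ^ 2 + 2 * ε * (q * s) ^ 2) := by
  intro N
  induction N with
  | zero =>
    intro p q hpq
    obtain ⟨rfl, rfl⟩ : p = 0 ∧ q = 0 := by omega
    exact ⟨1, one_pos, fun V G _ W s _ _ => ⟨∅, by simp, Or.inl (by simp)⟩⟩
  | succ N ih =>
    intro p q hpq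
    rcases p with _ | p
    · exact ⟨1, one_pos, fun V G _ W s _ _ => ⟨∅, by simp, Or.inl (by simp)⟩⟩
    rcases q with _ | q
    · exact ⟨1, one_pos, fun V G _ W s _ _ => ⟨∅, by simp, Or.inr (by simp)⟩⟩
    obtain ⟨δ₁, hδ₁, h₁⟩ := ih p (q + 1) (by omega)
    obtain ⟨δ₂, hδ₂, h₂⟩ := ih (p + 1) q (by omega)
    obtain ⟨γ, hγ, hpair⟩ := exists_disjoint_sparseTo hε
    obtain ⟨δ, hδ⟩ : ∃ δ : ℝ, δ = min (1 / 5) (min (γ / 2) (min (δ₁ * γ) (δ₂ * γ))) := ⟨_, rfl⟩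
    have hd1 : δ ≤ 1 / 5 := hδ ▸ min_le_left _ _
    have hd2 : δ ≤ γ / 2 := hδ ▸ (min_le_right _ _).trans (min_le_left _ _)
    have hd3 : δ ≤ δ₁ * γ :=
      hδ ▸ (min_le_right _ _).trans ((min_le_right _ _).trans (min_le_left _ _))
    have hd4 : δ ≤ δ₂ * γ :=
      hδ ▸ (min_le_right _ _).trans ((min_le_right _ _).trans (min_le_right _ _))
    refine ⟨δ, by rw [hδ]; positivity, ?_⟩
    intro V G hG W s hs1 hsW
    have hW0 : (0 : ℝ) ≤ W.card := Nat.cast_nonneg _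
    have hs1' : (1 : ℝ) ≤ s := by exact_mod_cast hs1
    have hW5 : 5 ≤ W.card := by
      have h1 := mul_le_mul_of_nonneg_right hd1 hW0
      have h2 : (5 : ℝ) ≤ W.card := by linarith
      exact_mod_cast h2
    obtain ⟨A, hA, B, hB, hAB, hAc, hBc, hsp⟩ := hpair V G hG W hW5
    have hsB : 2 * (s : ℝ) ≤ B.card := by
      have h1 := mul_le_mul_of_nonneg_right hd2 hW0
      linarith
    have hunion : A ∪ B ⊆ W := Finset.union_subset hA hB
    rcases hsp with hsp | hsp
    · obtain ⟨U, hUA, ⟨hU, hUe⟩ | hU⟩ := h₁ V G hG A s hs1 (by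
        have h1 := mul_le_mul_of_nonneg_right hd3 hW0
        have h2 := mul_le_mul_of_nonneg_left hAc hδ₁.le
        linarith)
      · obtain ⟨T, hT, hTc⟩ := hsp.exists_extension hε hAB hUA hU hUe hsB
        exact ⟨T, hT.trans hunion, Or.inl hTc⟩
      · exact ⟨U, hUA.trans hA, Or.inr hU⟩
    · obtain ⟨U, hUA, hU | ⟨hU, hUe⟩⟩ := h₂ V G hG A s hs1 (by
        have h1 := mul_le_mul_of_nonneg_right hd4 hW0
        have h2 := mul_le_mul_of_nonneg_left hAc hδ₂.le
        linarith)
      · exact ⟨U, hUA.trans hA, Or.inl hU⟩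
      · obtain ⟨T, hT, hTc⟩ := hsp.exists_extension hε hAB hUA hU hUe hsB
        exact ⟨T, hT.trans hunion, Or.inr hTc⟩

theorem exists_half_sparseOn {G : SimpleGraph V} {η : ℝ} (hη : 0 < η) (U : Finset V)
    (hU : ∑ u ∈ U, ((nbrsIn G u U).card : ℝ) ≤ η * (U.card : ℝ) ^ 2) :
    ∃ S ⊆ U, (U.card : ℝ) / 2 ≤ S.card ∧ SparseOn G S (4 * η) := by
  rcases U.eq_empty_or_nonempty with rfl | hUn
  · exact ⟨∅, subset_rfl, by simp, fun v hv => by simp at hv⟩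
  have hUpos : (0 : ℝ) < U.card := by exact_mod_cast hUn.card_pos
  obtain ⟨S, hS⟩ : ∃ S, S = U.filter fun u => ((nbrsIn G u U).card : ℝ) ≤ 2 * η * U.card :=
    ⟨_, rfl⟩
  obtain ⟨D, hD⟩ : ∃ D, D = U.filter fun u => 2 * η * U.card < ((nbrsIn G u U).card : ℝ) :=
    ⟨_, rfl⟩
  have hSU : S ⊆ U := hS ▸ Finset.filter_subset _ _
  have h2 : (S.card : ℝ) + D.card = U.card := by
    have h3 := Finset.card_filter_add_card_filter_not (s := U)
      (fun u => ((nbrsIn G u U).card : ℝ) ≤ 2 * η * U.card)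
    simp only [not_le] at h3
    rw [hS, hD]
    exact_mod_cast h3
  have h3 : (D.card : ℝ) * (2 * η * U.card) ≤ η * (U.card : ℝ) ^ 2 := by
    have h4 := Finset.card_nsmul_le_sum D (fun u => ((nbrsIn G u U).card : ℝ)) (2 * η * U.card)
      (fun u hu => by
        rw [hD] at hu
        exact (Finset.mem_filter.1 hu).2.le)
    rw [nsmul_eq_mul] at h4
    refine h4.trans (le_trans ?_ hU)
    exact Finset.sum_le_sum_of_subset_of_nonneg (hD ▸ Finset.filter_subset _ _)
      fun _ _ _ => Nat.cast_nonneg _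
  have h5 : (D.card : ℝ) ≤ U.card / 2 := by
    have h6 : (η * U.card) * (2 * D.card) ≤ (η * U.card) * (U.card : ℝ) := by linarith
    have := le_of_mul_le_mul_left h6 (by positivity)
    linarith
  refine ⟨S, hSU, by linarith, ?_⟩
  intro v hv
  have h6 : ((nbrsIn G v S).card : ℝ) ≤ (nbrsIn G v U).card := by
    exact_mod_cast Finset.card_le_card (nbrsIn_mono G v hSU)
  rw [hS] at hv
  have h7 := (Finset.mem_filter.1 hv).2
  have h8 : η * (U.card : ℝ) ≤ η * (2 * S.card) := by
    apply mul_le_mul_of_nonneg_left _ hη.le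
    linarith
  linarith

/-- Every large house-free graph has a linear-size set that is very sparse or very dense. -/
theorem exists_linear_sparseOn {ε : ℝ} (hε : 0 < ε) :
    ∃ δ : ℝ, 0 < δ ∧ ∀ (V : Type) (G : SimpleGraph V), Free P5ᶜ G → ∀ W : Finset V,
      1 / δ ≤ W.card → ∃ S ⊆ W, δ * W.card ≤ (S.card : ℝ) ∧
        (SparseOn G S ε ∨ SparseOn Gᶜ S ε) := by
  obtain ⟨K, hK⟩ := exists_nat_ge (max 1 (8 / ε))
  have hK1 : (1 : ℝ) ≤ K := (le_max_left _ _).trans hK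
  have hK2 : 8 ≤ K * ε := by
    have := (le_max_right _ _).trans hK
    rwa [div_le_iff₀ hε] at this
  obtain ⟨γ, hγ, h⟩ := exists_few_edges (show 0 < ε / 16 by positivity) (K + K) K K rfl
  refine ⟨γ / 4, by positivity, ?_⟩
  intro V G hG W hW
  have hγW : 4 ≤ γ * W.card := by
    rw [one_div_div, div_le_iff₀ hγ] at hW
    linarith
  obtain ⟨s, hs⟩ : ∃ s : ℕ, s = ⌊γ * W.card⌋₊ := ⟨_, rfl⟩
  have hs1 : (s : ℝ) ≤ γ * W.card := hs ▸ Nat.floor_le (by linarith)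
  have hs2 : γ * W.card < s + 1 := hs ▸ Nat.lt_floor_add_one _
  have hs3 : γ / 4 * W.card ≤ (s : ℝ) / 2 := by linarith
  have hs4 : 1 ≤ s := by
    have : (1 : ℝ) ≤ s := by linarith
    exact_mod_cast this
  have hfin : ∀ (H : SimpleGraph V) (U : Finset V), U ⊆ W → U.card = K * s →
      ∑ u ∈ U, ((nbrsIn H u U).card : ℝ) ≤ K * s ^ 2 + 2 * (ε / 16) * (K * s) ^ 2 →
      ∃ S ⊆ W, γ / 4 * W.card ≤ (S.card : ℝ) ∧ SparseOn H S ε := by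
    intro H U hUW hU hUe
    have hUR : (U.card : ℝ) = K * s := by exact_mod_cast hU
    obtain ⟨S, hSU, hSc, hS⟩ := exists_half_sparseOn (G := H) (η := ε / 4) (by positivity) U (by
      rw [hUR]
      have h1 : 0 ≤ (K : ℝ) * s ^ 2 := by positivity
      nlinarith [mul_le_mul_of_nonneg_left hK2 h1])
    refine ⟨S, hSU.trans hUW, ?_, ?_⟩
    · rw [hUR] at hSc
      have h1 : (s : ℝ) ≤ K * s := le_mul_of_one_le_left (Nat.cast_nonneg _) hK1
      linarith
    · have h1 : 4 * (ε / 4) = ε := by ring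
      rwa [h1] at hS
  obtain ⟨U, hUW, ⟨hU, hUe⟩ | ⟨hU, hUe⟩⟩ := h V G hG W s hs4 hs1
  · obtain ⟨S, hS1, hS2, hS3⟩ := hfin G U hUW hU hUe
    exact ⟨S, hS1, hS2, Or.inl hS3⟩
  · obtain ⟨S, hS1, hS2, hS3⟩ := hfin Gᶜ U hUW hU hUe
    exact ⟨S, hS1, hS2, Or.inr hS3⟩

end HouseFree

/-- house-free graphs have a pure or sparse blockade of polynomial size. -/
theorem house_free_pure_or_sparse :
    ∃ d : ℝ, 40 ≤ d ∧
      ∀ x : ℝ, 0 < x → x < (2 : ℝ) ^ (-d) →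
        ∀ (V : Type) [Fintype V] (G : SimpleGraph V),
          Free P5ᶜ G → x ^ (-d) ≤ (Fintype.card V : ℝ) →
          ∃ k : ℝ, 2 ≤ k ∧ k ≤ 1 / x ∧
            ∃ (n : ℕ) (B : Fin n → Finset V), IsBlockade B ∧ k ≤ (n : ℝ) ∧
              (∀ i, (Fintype.card V : ℝ) / k ^ d ≤ ((B i).card : ℝ)) ∧
              (PureBlockade G B ∨ SparseBlockade G x B) := by
  obtain ⟨δ, hδ, hδS⟩ := exists_linear_sparseOn (ε := (1 / 1296) ^ 2) (by norm_num)
  obtain ⟨c, hc⟩ := exists_pow_lt_of_lt_one hδ (show (1 / 1296 : ℝ) < 1 by norm_num)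
  obtain ⟨b, hb⟩ := pow_unbounded_of_one_lt (1000 / δ) (show (1 : ℝ) < 2 by norm_num)
  obtain ⟨d, hd⟩ : ∃ d : ℕ, d = 8 * (c + 1) + 40 + b := ⟨_, rfl⟩
  have hd2 : 1000 / δ ≤ 2 ^ d :=
    hb.le.trans (pow_le_pow_right₀ (by norm_num) (by omega))
  have hd3 : 1000 ≤ δ * 2 ^ d := by
    rw [div_le_iff₀ hδ] at hd2
    linarith
  have hd40 : (2 : ℝ) ^ 40 ≤ 2 ^ d := pow_le_pow_right₀ (by norm_num) (by omega)
  refine ⟨d, by exact_mod_cast (show 40 ≤ d by omega), ?_⟩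
  intro x hx hxd V _ G hG hV
  rw [Real.rpow_neg (by norm_num), Real.rpow_natCast] at hxd
  rw [Real.rpow_neg hx.le, Real.rpow_natCast, inv_eq_one_div] at hV
  have hx2 : x ≤ 1 / 1296 := by
    have h1 : ((2 : ℝ) ^ d)⁻¹ ≤ (2 ^ 40)⁻¹ := by gcongr
    have h2 : ((2 : ℝ) ^ 40)⁻¹ ≤ 1 / 1296 := by norm_num
    linarith
  have hVd : (2 : ℝ) ^ d ≤ Fintype.card V := by
    refine le_trans ?_ hV
    rw [le_div_iff₀ (by positivity), ← mul_pow]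
    exact pow_le_one₀ (by positivity) (by linarith)
  have hδV : 1000 ≤ δ * Fintype.card V := by
    have := mul_le_mul_of_nonneg_left hVd hδ.le
    linarith
  suffices h : HasPureOrSparseBlockade G x (Fintype.card V) d by
    obtain ⟨k, hk2, hkx, n, B, hB, hkn, hBs, hBp⟩ := h
    refine ⟨k, hk2, hkx, n, B, hB, hkn, ?_, hBp⟩
    simpa only [Real.rpow_natCast] using hBs
  obtain ⟨S, -, hSc, hS⟩ := hδS V G hG Finset.univ (by
    rw [Finset.card_univ, div_le_iff₀ hδ]
    linarith)
  rw [Finset.card_univ] at hSc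
  rcases hS with hS | hS
  · refine SparseOn.hasPureOrSparseBlockade hG hx hx2 (show 1 ≤ c + 1 by omega) (by omega) hV S hS
      (le_trans ?_ hSc)
    refine mul_le_mul_of_nonneg_right (le_trans ?_ hc.le) (Nat.cast_nonneg _)
    exact pow_le_pow_of_le_one (by norm_num) (by norm_num) (by omega)
  · have hS' : SparseOn Gᶜ S (1 / 1000) := fun v hv =>
      (hS v hv).trans (mul_le_mul_of_nonneg_right (by norm_num) (Nat.cast_nonneg _))
    obtain ⟨B, hB, hBc, hBs⟩ := hS'.exists_completeBlockade hG S (by linarith)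
    refine ⟨2, le_rfl, ?_, 2, B, hB, by norm_num, fun i => le_trans ?_ (hBs i),
      Or.inl fun i j hij => Or.inl (hBc i j hij)⟩
    · rw [le_div_iff₀ hx]
      linarith
    · rw [div_le_div_iff₀ (by positivity) (by norm_num)]
      have h1 := mul_le_mul_of_nonneg_right hSc (show (0 : ℝ) ≤ 2 ^ d by positivity)
      have h2 := mul_le_mul_of_nonneg_right hd3 (Nat.cast_nonneg (α := ℝ) (Fintype.card V))
      have h3 : (0 : ℝ) ≤ Fintype.card V := Nat.cast_nonneg _
      linarith
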